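/- arXiv:2001.08820 — 6 statements merged into one kernel-verified Lean document; each statement's English description precedes it below -/
import Mathlib

section
/- Let a : ℕ → ℝ be a sequence of distinct positive reals, let ε > 0, and set M = N^{1+ε}, K = N^ε. Let f : ℝ → ℝ be smooth and compactly supported, and let ρ : ℝ → ℝ be smooth, compactly supported, nonnegative with ∫_{-∞}^{∞} ρ(α) dα = 1. Assume there are δ > 0 and c₀ > 0 such that for all N ≥ 1, #{(n,x,y) ∈ ℤ³ : 1 ≤ n ≤ M, 1 ≤ x, y ≤ N, x ≠ y, n·|a(x) − a(y)| < K} ≤ c₀·N^{2−δ}. Then there exist δ' > 0 and c₁ > 0 such that for all N ≥ 1, the average of the pair correlation satisfies |∫_{-∞}^{∞} R₂(f,N)(α)·ρ(α) dα − ∫_{-∞}^{∞} f(x) dx| ≤ c₁·N^{−δ'}, where R₂(f,N)(α) = (1/N) · Σ_{1 ≤ m ≠ n ≤ N} Σ_{j ∈ ℤ} f(N·(α·a(n) − α·a(m) + j)). -/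
open MeasureTheory Filter

/-- The smoothed pair correlation function
`R₂(f,N)(α) = (1/N) · Σ_{1 ≤ m ≠ n ≤ N} Σ_{j ∈ ℤ} f(N·(α·a(n) − α·a(m) + j))`. -/
noncomputable def R2 (a : ℕ → ℝ) (f : ℝ → ℝ) (N : ℕ) (α : ℝ) : ℝ :=
  (1 / (N : ℝ)) * ∑ m ∈ Finset.Icc 1 N, ∑ n ∈ Finset.Icc 1 N,
    if m ≠ n then (∑' j : ℤ, f ((N : ℝ) * (α * a n - α * a m + (j : ℝ)))) else 0

/-- The count of triples `(n,x,y)` with `1 ≤ n ≤ M` (an integer), `1 ≤ x ≠ y ≤ N`,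
and `n·|a(x) − a(y)| < K`. -/
noncomputable def countA (a : ℕ → ℝ) (M K : ℝ) (N : ℕ) : ℕ :=
  Set.ncard {t : ℤ × ℕ × ℕ |
    1 ≤ t.1 ∧ (t.1 : ℝ) ≤ M ∧
    1 ≤ t.2.1 ∧ t.2.1 ≤ N ∧ 1 ≤ t.2.2 ∧ t.2.2 ≤ N ∧ t.2.1 ≠ t.2.2 ∧
    (t.1 : ℝ) * |a t.2.1 - a t.2.2| < K}

open scoped SchwartzMap FourierTransform

lemma SchwartzMap.exists_pow_mul_norm_le (H : 𝓢(ℝ, ℂ)) (p : ℕ) :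
    ∃ C : ℝ, 0 < C ∧ ∀ x : ℝ, |x| ^ p * ‖H x‖ ≤ C := by
  obtain ⟨C, hC, h⟩ := H.decay p 0
  exact ⟨C, hC, fun x => by simpa using h x⟩

lemma fourier_comp_const_mul (F : ℝ → ℂ) {L : ℝ} (hL : 0 < L) (w : ℝ) :
    𝓕 (fun x => F (L * x)) w = (1 / L : ℂ) * 𝓕 F (w / L) := by
  rw [Real.fourier_real_eq, Real.fourier_real_eq]
  have h := Measure.integral_comp_mul_left
    (fun v : ℝ => Real.fourierChar (-(v * (w / L))) • F v) L
  rw [abs_of_pos (inv_pos.2 hL)] at h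
  have e : ∀ v : ℝ, L * v * (w / L) = v * w := fun v => by field_simp
  simp only [e] at h
  rw [h, Complex.real_smul]
  push_cast
  rw [one_div]

lemma SchwartzMap.summable_int_div (H : 𝓢(ℝ, ℂ)) {L : ℝ} (hL : 0 < L) :
    Summable fun k : ℤ => ‖H (k / L)‖ := by
  obtain ⟨C, hC, h⟩ := H.exists_pow_mul_norm_le 2
  have hs : Summable fun k : ℤ => C * L ^ 2 * (1 / (k : ℝ) ^ 2) :=
    (Real.summable_one_div_int_pow.2 one_lt_two).mul_left _
  refine hs.of_norm_bounded_eventually ?_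
  have : ∀ᶠ k : ℤ in cofinite, k ≠ 0 := by simp [-Int.cofinite_eq, eventually_cofinite]
  filter_upwards [this] with k hk
  have hk' : (0 : ℝ) < (k : ℝ) ^ 2 := by positivity
  have := h (k / L)
  rw [sq_abs, div_pow] at this
  rw [norm_norm, mul_one_div, le_div_iff₀ hk']
  calc ‖H (k / L)‖ * (k : ℝ) ^ 2 = (k : ℝ) ^ 2 / L ^ 2 * ‖H (k / L)‖ * L ^ 2 := by field_simp
    _ ≤ C * L ^ 2 := by gcongr

lemma SchwartzMap.tsum_comp_const_mul_add_int (F : 𝓢(ℝ, ℂ)) {L : ℝ} (hL : 0 < L) (y : ℝ) :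
    ∑' j : ℤ, F (L * (y + j)) =
      ∑' k : ℤ, (1 / L : ℂ) * 𝓕 F (k / L) * Real.fourierChar (k * y) := by
  let e : ℝ ≃L[ℝ] ℝ := ContinuousLinearEquiv.unitsEquivAut ℝ (Units.mk0 L hL.ne')
  have hF : ∀ x, SchwartzMap.compCLMOfContinuousLinearEquiv ℂ e F x = F (L * x) := fun x => by
    simp [e, mul_comm]
  have h := SchwartzMap.tsum_eq_tsum_fourier (SchwartzMap.compCLMOfContinuousLinearEquiv ℂ e F) y
  simp only [hF] at h
  rw [h]
  refine tsum_congr fun k => ?_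
  rw [SchwartzMap.fourier_coe, SchwartzMap.fourier_coe, show
    (SchwartzMap.compCLMOfContinuousLinearEquiv ℂ e F : ℝ → ℂ) = fun x => F (L * x) from funext hF,
    fourier_comp_const_mul _ hL, fourier_coe_apply, Real.fourierChar_apply]
  congr 2
  push_cast
  ring

lemma SchwartzMap.continuous_tsum_comp_const_mul_add_int (F : 𝓢(ℝ, ℂ)) {L : ℝ} (hL : 0 < L) :
    Continuous fun y : ℝ => ∑' j : ℤ, F (L * (y + j)) := by
  simp only [F.tsum_comp_const_mul_add_int hL]
  refine continuous_tsum (fun k => by fun_prop)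
    (((𝓕 F).summable_int_div hL).mul_left ‖(1 / L : ℂ)‖) fun k y => ?_
  rw [norm_mul, norm_mul, Circle.norm_coe, mul_one]

lemma SchwartzMap.integrable_tsum_mul (F G : 𝓢(ℝ, ℂ)) (hG : HasCompactSupport G) {L : ℝ}
    (hL : 0 < L) (d : ℝ) :
    Integrable fun α : ℝ => (∑' j : ℤ, F (L * (α * d + j))) * G α := by
  have h : Continuous fun α : ℝ => ∑' j : ℤ, F (L * (α * d + j)) :=
    (F.continuous_tsum_comp_const_mul_add_int hL).comp (continuous_id.mul continuous_const)
  exact (h.mul G.continuous).integrable_of_hasCompactSupport hG.mul_left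

lemma SchwartzMap.integral_tsum_mul (F G : 𝓢(ℝ, ℂ)) {L : ℝ} (hL : 0 < L) (d : ℝ) :
    ∫ α : ℝ, (∑' j : ℤ, F (L * (α * d + j))) * G α =
      ∑' k : ℤ, (1 / L : ℂ) * 𝓕 F (k / L) * 𝓕 G (-(k * d)) := by
  simp only [F.tsum_comp_const_mul_add_int hL, ← tsum_mul_right]
  have hi : ∀ k : ℤ, Integrable fun α : ℝ =>
      (1 / L : ℂ) * 𝓕 F (k / L) * Real.fourierChar (k * (α * d)) * G α := fun k => by
    refine (G.integrable.norm.const_mul ‖(1 / L : ℂ) * 𝓕 F (k / L)‖).mono'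
      (Continuous.aestronglyMeasurable (by fun_prop)) (.of_forall fun α => ?_)
    rw [norm_mul, norm_mul _ (Real.fourierChar _ : ℂ), Circle.norm_coe, mul_one]
  rw [← integral_tsum_of_summable_integral_norm hi]
  · refine tsum_congr fun k => ?_
    simp only [mul_assoc, integral_const_mul]
    rw [SchwartzMap.fourier_coe G, Real.fourier_real_eq]
    congr 3
    funext α
    simp only [Circle.smul_def, smul_eq_mul]
    congr 3
    ring
  · refine (((𝓕 F).summable_int_div hL).mul_left (‖(1 / L : ℂ)‖ * ∫ α, ‖G α‖)).congr fun k => ?_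
    simp only [norm_mul, integral_const_mul, Circle.norm_coe, mul_one]
    ring

/-- The integers `1 ≤ k ≤ M` with `k·|d| < K`. -/
noncomputable def smallMultiples (M K d : ℝ) : Finset ℤ :=
  {k ∈ Finset.Icc 1 ⌊M⌋ | (k : ℝ) * |d| < K}

lemma mem_smallMultiples {M K d : ℝ} {k : ℤ} :
    k ∈ smallMultiples M K d ↔ 1 ≤ k ∧ (k : ℝ) ≤ M ∧ (k : ℝ) * |d| < K := by
  simp [smallMultiples, Int.le_floor, and_assoc]

lemma sum_card_smallMultiples (a : ℕ → ℝ) (M K : ℝ) (N : ℕ) :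
    ∑ m ∈ Finset.Icc 1 N, ∑ n ∈ Finset.Icc 1 N,
      (if m ≠ n then (smallMultiples M K (a n - a m)).card else 0) = countA a M K N := by
  have h : {t : ℤ × ℕ × ℕ |
      1 ≤ t.1 ∧ (t.1 : ℝ) ≤ M ∧
      1 ≤ t.2.1 ∧ t.2.1 ≤ N ∧ 1 ≤ t.2.2 ∧ t.2.2 ≤ N ∧ t.2.1 ≠ t.2.2 ∧
      (t.1 : ℝ) * |a t.2.1 - a t.2.2| < K} =
      (({t ∈ Finset.Icc 1 ⌊M⌋ ×ˢ Finset.Icc 1 N ×ˢ Finset.Icc 1 N |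
        t.2.1 ≠ t.2.2 ∧ (t.1 : ℝ) * |a t.2.2 - a t.2.1| < K} : Finset (ℤ × ℕ × ℕ)) :
        Set (ℤ × ℕ × ℕ)) := by
    ext ⟨k, m, n⟩
    simp only [Set.mem_ofPred_eq, Finset.coe_filter, Finset.mem_product, Finset.mem_Icc,
      Int.le_floor, abs_sub_comm (a m)]
    tauto
  rw [countA, h, Set.ncard_coe_finset, Finset.card_filter, Finset.sum_product_right,
    Finset.sum_product]
  refine Finset.sum_congr rfl fun m _ => Finset.sum_congr rfl fun n _ => ?_
  by_cases hmn : m = n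
  · simp [hmn]
  · simp only [ne_eq, hmn, not_false_eq_true, if_true, true_and, smallMultiples]
    rw [Finset.card_filter]

lemma SchwartzMap.exists_norm_mul_le (H₁ H₂ : 𝓢(ℝ, ℂ)) {ε : ℝ} (hε : 0 < ε) :
    ∃ C : ℝ, 0 < C ∧ ∀ N : ℕ, 1 ≤ N → ∀ d : ℝ, ∀ k : ℤ, k ≠ 0 →
      ‖H₁ (k / N)‖ * ‖H₂ (-(k * d))‖ ≤ C * ((N : ℝ)⁻¹ * (1 / (k : ℝ) ^ 2) +
        if |(k : ℝ)| ≤ (N : ℝ) ^ (1 + ε) ∧ |(k : ℝ)| * |d| < (N : ℝ) ^ ε then 1 else 0) := by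
  obtain ⟨q, hq⟩ := exists_nat_ge ((3 + 2 * ε) / ε)
  rw [div_le_iff₀ hε] at hq
  obtain ⟨A₀, hA₀, h₁⟩ := H₁.exists_pow_mul_norm_le 0
  obtain ⟨A, hA, h₁q⟩ := H₁.exists_pow_mul_norm_le (q + 2)
  obtain ⟨B₀, hB₀, h₂⟩ := H₂.exists_pow_mul_norm_le 0
  obtain ⟨B, hB, h₂q⟩ := H₂.exists_pow_mul_norm_le q
  simp only [pow_zero, one_mul] at h₁ h₂
  refine ⟨A₀ * B₀ + A * B₀ + A₀ * B, by positivity, fun N hN d k hk => ?_⟩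
  have hN0 : (0 : ℝ) < N := by exact_mod_cast hN
  have hN1 : (1 : ℝ) ≤ N := by exact_mod_cast hN
  have hk0 : (0 : ℝ) < |(k : ℝ)| := by positivity
  have hkk : (k : ℝ) ^ 2 = |(k : ℝ)| ^ 2 := (sq_abs _).symm
  have hkd : |-(k * d)| = |(k : ℝ)| * |d| := by rw [abs_neg, abs_mul]
  have hkN : |(k : ℝ) / N| = |(k : ℝ)| / N := by rw [abs_div, abs_of_pos hN0]
  have hpow : (N : ℝ) ^ (3 + 2 * ε) ≤ ((N : ℝ) ^ ε) ^ q := by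
    rw [← Real.rpow_mul_natCast hN0.le]
    exact Real.rpow_le_rpow_of_exponent_le hN1 (by linarith)
  have hpow3 : (N : ℝ) ^ 3 ≤ (N : ℝ) ^ (3 + 2 * ε) := by
    rw [← Real.rpow_natCast]
    exact Real.rpow_le_rpow_of_exponent_le hN1 (by push_cast; linarith)
  have hsplit : (N : ℝ) ^ (3 + 2 * ε) = N * ((N : ℝ) ^ (1 + ε)) ^ 2 := by
    rw [← Real.rpow_mul_natCast hN0.le, ← Real.rpow_one_add' hN0.le (by positivity)]
    congr 1
    push_cast
    ring
  have hMdef : (N : ℝ) ^ (1 + ε) = N * (N : ℝ) ^ ε := by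
    rw [Real.rpow_add hN0, Real.rpow_one]
  have hmain : ∀ c : ℝ, 0 ≤ c → c ≤ A₀ * B₀ + A * B₀ + A₀ * B →
      c * ((N : ℝ)⁻¹ * (1 / |(k : ℝ)| ^ 2)) ≤ (A₀ * B₀ + A * B₀ + A₀ * B) *
        ((N : ℝ)⁻¹ * (1 / |(k : ℝ)| ^ 2) + 0) := fun c _ hc => by
    rw [add_zero]
    gcongr
  rw [hkk]
  by_cases hM : |(k : ℝ)| ≤ (N : ℝ) ^ (1 + ε)
  · by_cases hK : |(k : ℝ)| * |d| < (N : ℝ) ^ ε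
    · rw [if_pos ⟨hM, hK⟩]
      calc ‖H₁ (k / N)‖ * ‖H₂ (-(k * d))‖ ≤ A₀ * B₀ := by
            gcongr
            · exact h₁ _
            · exact h₂ _
        _ ≤ (A₀ * B₀ + A * B₀ + A₀ * B) * 1 := by
            have := mul_pos hA hB₀
            have := mul_pos hA₀ hB
            linarith
        _ ≤ _ := by
            gcongr
            exact le_add_of_nonneg_left (by positivity)
    · rw [if_neg fun h => hK h.2]
      refine le_trans ?_ (hmain (A₀ * B) (by positivity) (by
        have := mul_pos hA hB₀
        have := mul_pos hA₀ hB₀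
        linarith))
      rw [mul_assoc]
      refine mul_le_mul (h₁ _) ?_ (norm_nonneg _) hA₀.le
      have h := h₂q (-(k * d))
      rw [hkd] at h
      have hle : (N : ℝ) * |(k : ℝ)| ^ 2 ≤ (|(k : ℝ)| * |d|) ^ q :=
        calc (N : ℝ) * |(k : ℝ)| ^ 2 ≤ N * ((N : ℝ) ^ (1 + ε)) ^ 2 := by gcongr
          _ ≤ ((N : ℝ) ^ ε) ^ q := hsplit ▸ hpow
          _ ≤ _ := by
            gcongr
            exact not_lt.1 hK
      rw [← one_div, one_div_mul_one_div, mul_one_div, le_div_iff₀ (by positivity)]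
      calc _ ≤ ‖H₂ (-(k * d))‖ * (|(k : ℝ)| * |d|) ^ q := by gcongr
        _ ≤ B := by rw [mul_comm]; exact h
  · rw [if_neg fun h => hM h.1]
    refine le_trans ?_ (hmain (A * B₀) (by positivity) (by
      have := mul_pos hA₀ hB
      have := mul_pos hA₀ hB₀
      linarith))
    rw [mul_right_comm]
    refine mul_le_mul ?_ (h₂ _) (norm_nonneg _) (by positivity)
    have h := h₁q (k / N)
    rw [hkN] at h
    have hle : (N : ℝ) * |(k : ℝ)| ^ 2 ≤ (|(k : ℝ)| / N) ^ (q + 2) := by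
      have hKk : (N : ℝ) ^ ε ≤ |(k : ℝ)| / N := by
        rw [le_div_iff₀ hN0, mul_comm, ← hMdef]
        exact (not_le.1 hM).le
      calc (N : ℝ) * |(k : ℝ)| ^ 2 = N ^ 3 * (|(k : ℝ)| / N) ^ 2 := by field_simp
        _ ≤ ((N : ℝ) ^ ε) ^ q * (|(k : ℝ)| / N) ^ 2 := by
            gcongr
            exact hpow3.trans hpow
        _ ≤ (|(k : ℝ)| / N) ^ q * (|(k : ℝ)| / N) ^ 2 := by gcongr
        _ = _ := (pow_add _ _ _).symm
    rw [← one_div, one_div_mul_one_div, mul_one_div, le_div_iff₀ (by positivity)]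
    calc _ ≤ ‖H₁ (k / N)‖ * (|(k : ℝ)| / N) ^ (q + 2) := by gcongr
      _ ≤ A := by rw [mul_comm]; exact h

lemma hasSum_ite_mem_smallMultiples (M K d : ℝ) :
    HasSum (fun k : ℤ => if k ≠ 0 ∧ |(k : ℝ)| ≤ M ∧ |(k : ℝ)| * |d| < K then (1 : ℝ) else 0)
      (2 * (smallMultiples M K d).card) := by
  have h : HasSum (fun k : ℤ => if k ∈ smallMultiples M K d then (1 : ℝ) else 0)
      (smallMultiples M K d).card := by
    have := hasSum_sum_of_ne_finset_zero (L := .unconditional ℤ) (s := smallMultiples M K d)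
      (f := fun k : ℤ => if k ∈ smallMultiples M K d then (1 : ℝ) else 0) (by simp_all)
    simpa using this
  have h' := h.add ((Equiv.neg ℤ).hasSum_iff.2 h)
  rw [← two_mul] at h'
  convert! h' using 2 with k
  simp only [Function.comp_apply, Equiv.neg_apply, mem_smallMultiples]
  rcases lt_trichotomy k 0 with hk | rfl | hk
  · have hk' : |(k : ℝ)| = -k := abs_of_neg (by exact_mod_cast hk)
    rw [hk', if_neg (by omega : ¬ (1 ≤ k ∧ _)), zero_add]
    have h1 : k ≠ 0 := hk.ne
    have h2 : 1 ≤ -k := by omega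
    simp [h1, h2]
  · simp
  · have hk' : |(k : ℝ)| = k := abs_of_pos (by exact_mod_cast hk)
    rw [hk', if_neg (by omega : ¬ (1 ≤ -k ∧ _)), add_zero]
    have h1 : k ≠ 0 := hk.ne'
    have h2 : 1 ≤ k := by omega
    simp [h1, h2]

lemma SchwartzMap.exists_norm_integral_tsum_sub_le (F G : 𝓢(ℝ, ℂ)) {ε : ℝ} (hε : 0 < ε) :
    ∃ C : ℝ, 0 < C ∧ ∀ N : ℕ, 1 ≤ N → ∀ d : ℝ,
      ‖(∫ α : ℝ, (∑' j : ℤ, F (N * (α * d + j))) * G α) - (1 / N : ℂ) * 𝓕 F 0 * 𝓕 G 0‖ ≤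
        C / N * ((N : ℝ)⁻¹ + (smallMultiples ((N : ℝ) ^ (1 + ε)) ((N : ℝ) ^ ε) d).card) := by
  obtain ⟨C, hC, h⟩ := (𝓕 F).exists_norm_mul_le (𝓕 G) hε
  obtain ⟨B, hB, hG⟩ := (𝓕 G).exists_pow_mul_norm_le 0
  simp only [pow_zero, one_mul] at hG
  have hS : HasSum (fun k : ℤ => 1 / (k : ℝ) ^ 2) (∑' k : ℤ, 1 / (k : ℝ) ^ 2) :=
    (Real.summable_one_div_int_pow.2 one_lt_two).hasSum
  set S : ℝ := ∑' k : ℤ, 1 / (k : ℝ) ^ 2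
  have hS0 : 0 ≤ S := tsum_nonneg fun k => by positivity
  refine ⟨C * (S + 2), by positivity, fun N hN d => ?_⟩
  have hN0 : (0 : ℝ) < N := by exact_mod_cast hN
  have hint := F.integral_tsum_mul G hN0 d
  rw [Complex.ofReal_natCast] at hint
  have hsum : Summable fun k : ℤ => (1 / N : ℂ) * 𝓕 F (k / N) * 𝓕 G (-(k * d)) := by
    refine .of_norm_bounded (((𝓕 F).summable_int_div hN0).mul_left (‖(1 / N : ℂ)‖ * B))
      fun k => ?_
    rw [norm_mul, norm_mul, mul_right_comm]
    gcongr
    exact hG _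
  have h0 := hsum.tsum_eq_add_tsum_ite 0
  simp only [Int.cast_zero, zero_div, zero_mul, neg_zero] at h0
  rw [hint, h0, add_sub_cancel_left]
  have hbound := ((hS.mul_left (N : ℝ)⁻¹).add
    (hasSum_ite_mem_smallMultiples ((N : ℝ) ^ (1 + ε)) ((N : ℝ) ^ ε) d)).mul_left (C / N)
  refine (tsum_of_norm_bounded hbound fun k => ?_).trans ?_
  · by_cases hk : k = 0
    · rw [if_pos hk, norm_zero]
      positivity
    · have hb := h N hN d k hk
      rw [if_neg hk, norm_mul, norm_mul, mul_assoc, norm_div, norm_one, Complex.norm_natCast,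
        one_div_mul_eq_div, div_mul_eq_mul_div]
      simp only [ne_eq, hk, not_false_eq_true, true_and]
      gcongr
  · rw [mul_div_right_comm, mul_assoc]
    gcongr
    have hN' : (0 : ℝ) ≤ (N : ℝ)⁻¹ := by positivity
    have hc : (0 : ℝ) ≤ (smallMultiples ((N : ℝ) ^ (1 + ε)) ((N : ℝ) ^ ε) d).card := by positivity
    nlinarith [mul_nonneg hS0 hc]

lemma SchwartzMap.integral_R2_mul (F G : 𝓢(ℝ, ℂ)) (hG : HasCompactSupport G) {f ρ : ℝ → ℝ}
    (hF : ∀ x, F x = f x) (hGρ : ∀ x, G x = ρ x) (a : ℕ → ℝ) {N : ℕ} (hN : 1 ≤ N) :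
    ((∫ α : ℝ, R2 a f N α * ρ α : ℝ) : ℂ) =
      (1 / N : ℂ) * ∑ m ∈ Finset.Icc 1 N, ∑ n ∈ Finset.Icc 1 N,
        if m ≠ n then ∫ α : ℝ, (∑' j : ℤ, F (N * (α * (a n - a m) + j))) * G α else 0 := by
  have hN0 : (0 : ℝ) < N := by exact_mod_cast hN
  have hpt : ∀ α : ℝ, ((R2 a f N α * ρ α : ℝ) : ℂ) =
      (1 / N : ℂ) * ∑ m ∈ Finset.Icc 1 N, ∑ n ∈ Finset.Icc 1 N,
        if m ≠ n then (∑' j : ℤ, F (N * (α * (a n - a m) + j))) * G α else 0 := fun α => by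
    rw [R2, Complex.ofReal_mul, Complex.ofReal_mul, mul_assoc, ← hGρ, Complex.ofReal_sum,
      Finset.sum_mul]
    push_cast
    congr 1
    refine Finset.sum_congr rfl fun m _ => ?_
    rw [Finset.sum_mul]
    refine Finset.sum_congr rfl fun n _ => ?_
    split_ifs
    · simp only [hF, Complex.ofReal_tsum, mul_sub]
    · simp
  have hi : ∀ m n : ℕ, Integrable fun α : ℝ =>
      if m ≠ n then (∑' j : ℤ, F (N * (α * (a n - a m) + j))) * G α else 0 := fun m n => by
    split_ifs
    · exact F.integrable_tsum_mul G hG hN0 _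
    · exact integrable_zero _ _ _
  rw [← integral_complex_ofReal]
  simp only [hpt, integral_const_mul]
  congr 1
  rw [integral_finsetSum _ fun m _ => integrable_finsetSum _ fun n _ => hi m n]
  refine Finset.sum_congr rfl fun m _ => ?_
  rw [integral_finsetSum _ fun n _ => hi m n]
  refine Finset.sum_congr rfl fun n _ => ?_
  split_ifs
  · rfl
  · simp

lemma HasCompactSupport.exists_schwartzMap_ofReal {f : ℝ → ℝ} (hf : ContDiff ℝ (⊤ : ℕ∞) f)
    (hfc : HasCompactSupport f) :
    ∃ F : 𝓢(ℝ, ℂ), HasCompactSupport F ∧ (∀ x, F x = f x) ∧ 𝓕 F 0 = ((∫ x, f x : ℝ) : ℂ) := by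
  have hc : HasCompactSupport fun x => (f x : ℂ) := hfc.comp_left Complex.ofReal_zero
  refine ⟨hc.toSchwartzMap (Complex.ofRealCLM.contDiff.comp hf), hc, fun x => rfl, ?_⟩
  rw [SchwartzMap.fourier_coe, Real.fourier_real_eq, ← integral_complex_ofReal]
  refine integral_congr_ae (.of_forall fun x => ?_)
  simp only [mul_zero, neg_zero, AddChar.map_zero_eq_one, one_smul]
  rfl

/-- (Expected value of the pair correlation.) Under the counting
condition (A) with `M = N^{1+ε}`, `K = N^ε`, the smooth average of `R₂(f,N)` over `α`
is `∫ f + O(N^{−δ'})`. -/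
theorem average_pair_correlation
    (a : ℕ → ℝ)
    (hpos : ∀ x : ℕ, 1 ≤ x → 0 < a x)
    (hdist : ∀ x y : ℕ, 1 ≤ x → 1 ≤ y → x ≠ y → a x ≠ a y)
    (ε : ℝ) (hε : 0 < ε)
    (f : ℝ → ℝ) (hf : ContDiff ℝ (⊤ : ℕ∞) f) (hfc : HasCompactSupport f)
    (ρ : ℝ → ℝ) (hρ : ContDiff ℝ (⊤ : ℕ∞) ρ) (hρc : HasCompactSupport ρ)
    (hρ0 : ∀ x : ℝ, 0 ≤ ρ x) (hρ1 : ∫ x : ℝ, ρ x = 1)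
    (δ c₀ : ℝ) (hδ : 0 < δ) (hc₀ : 0 < c₀)
    (hA : ∀ N : ℕ, 1 ≤ N →
      (countA a ((N : ℝ) ^ ((1 : ℝ) + ε)) ((N : ℝ) ^ ε) N : ℝ) ≤ c₀ * (N : ℝ) ^ ((2 : ℝ) - δ)) :
    ∃ δ' : ℝ, 0 < δ' ∧ ∃ c₁ : ℝ, 0 < c₁ ∧ ∀ N : ℕ, 1 ≤ N →
      |(∫ α : ℝ, R2 a f N α * ρ α) - ∫ x : ℝ, f x| ≤ c₁ * (N : ℝ) ^ (-δ') := by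
  obtain ⟨F, -, hF, hF0⟩ := hfc.exists_schwartzMap_ofReal hf
  obtain ⟨G, hG, hGρ, hG0⟩ := hρc.exists_schwartzMap_ofReal hρ
  rw [hρ1, Complex.ofReal_one] at hG0
  obtain ⟨C, hC, hE⟩ := F.exists_norm_integral_tsum_sub_le G hε
  simp only [hF0, hG0, mul_one] at hE
  refine ⟨min 1 δ, by positivity, C + C * c₀ + |∫ x, f x|, by positivity, fun N hN => ?_⟩
  have hN0 : (0 : ℝ) < N := by exact_mod_cast hN
  have hN1 : (1 : ℝ) ≤ N := by exact_mod_cast hN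
  have hNC : (N : ℂ) ≠ 0 := by exact_mod_cast hN0.ne'
  set I : ℝ := ∫ x, f x
  set c : ℕ → ℕ → ℕ := fun m n =>
    (smallMultiples ((N : ℝ) ^ (1 + ε)) ((N : ℝ) ^ ε) (a n - a m)).card
  have hcount : ((∑ m ∈ Finset.Icc 1 N, ∑ n ∈ Finset.Icc 1 N,
      if m ≠ n then c m n else 0 : ℕ) : ℝ) ≤ c₀ * (N : ℝ) ^ (2 - δ) := by
    rw [sum_card_smallMultiples]
    exact hA N hN
  push_cast at hcount
  have hterm : ∀ m n : ℕ, ‖(if m ≠ n then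
      ∫ α : ℝ, (∑' j : ℤ, F (N * (α * (a n - a m) + j))) * G α else 0) - (1 / N : ℂ) * I‖ ≤
      C / N * (N : ℝ)⁻¹ + C / N * (if m ≠ n then (c m n : ℝ) else 0) +
        (if m = n then |I| / N else 0) := fun m n => by
    by_cases hmn : m = n
    · simp only [hmn, ne_eq, not_true_eq_false, if_false, if_true, mul_zero, add_zero, zero_sub,
        norm_neg, norm_mul, norm_div, norm_one, Complex.norm_natCast, Complex.norm_real,
        Real.norm_eq_abs]
      rw [one_div_mul_eq_div]
      exact le_add_of_nonneg_left (by positivity)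
    · simp only [ne_eq, hmn, not_false_eq_true, if_true, if_false, add_zero, ← mul_add]
      exact hE N hN _
  have hsum : ((∫ α : ℝ, R2 a f N α * ρ α : ℝ) : ℂ) - I =
      (1 / N : ℂ) * ∑ m ∈ Finset.Icc 1 N, ∑ n ∈ Finset.Icc 1 N, ((if m ≠ n then
        ∫ α : ℝ, (∑' j : ℤ, F (N * (α * (a n - a m) + j))) * G α else 0) - (1 / N : ℂ) * I) := by
    rw [F.integral_R2_mul G hG hF hGρ a hN]
    simp only [Finset.sum_sub_distrib, mul_sub, Finset.sum_const, Nat.card_Icc, nsmul_eq_mul,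
      add_tsub_cancel_right]
    congr 1
    field_simp
  rw [← Real.norm_eq_abs, ← Complex.norm_real, Complex.ofReal_sub, hsum, norm_mul, norm_div,
    norm_one, Complex.norm_natCast]
  have hdelta : (N : ℝ) ^ (2 - δ) = N ^ 2 * (N : ℝ) ^ (-δ) := by
    rw [sub_eq_add_neg, Real.rpow_add hN0, Real.rpow_two]
  have h1 : (N : ℝ)⁻¹ ≤ (N : ℝ) ^ (-min 1 δ) := by
    rw [← Real.rpow_neg_one]
    exact Real.rpow_le_rpow_of_exponent_le hN1 (neg_le_neg (min_le_left _ _))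
  have h2 : (N : ℝ) ^ (-δ) ≤ (N : ℝ) ^ (-min 1 δ) :=
    Real.rpow_le_rpow_of_exponent_le hN1 (neg_le_neg (min_le_right _ _))
  calc _ ≤ 1 / (N : ℝ) * ∑ m ∈ Finset.Icc 1 N, ∑ n ∈ Finset.Icc 1 N,
        (C / N * (N : ℝ)⁻¹ + C / N * (if m ≠ n then (c m n : ℝ) else 0) +
          (if m = n then |I| / N else 0)) := by
        gcongr
        exact norm_sum_le_of_le _ fun m _ => norm_sum_le_of_le _ fun n _ => hterm m n
    _ = 1 / (N : ℝ) * (N * (N * (C / N * (N : ℝ)⁻¹)) + C / N * (∑ m ∈ Finset.Icc 1 N,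
          ∑ n ∈ Finset.Icc 1 N, if m ≠ n then (c m n : ℝ) else 0) + N * (|I| / N)) := by
        simp only [Finset.sum_add_distrib, ← Finset.mul_sum, Finset.sum_const, Nat.card_Icc,
          nsmul_eq_mul, add_tsub_cancel_right]
        rw [Finset.sum_congr rfl fun m hm => (Finset.sum_ite_eq (Finset.Icc 1 N) m
          fun _ => |I| / (N : ℝ)).trans (if_pos hm)]
        simp only [Finset.sum_const, Nat.card_Icc, nsmul_eq_mul, add_tsub_cancel_right]
        ring
    _ ≤ 1 / (N : ℝ) * (N * (N * (C / N * (N : ℝ)⁻¹)) + C / N * (c₀ * (N : ℝ) ^ (2 - δ)) +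
          N * (|I| / N)) := by gcongr
    _ = C * (N : ℝ)⁻¹ + C * c₀ * (N : ℝ) ^ (-δ) + |I| * (N : ℝ)⁻¹ := by
        rw [hdelta]
        field_simp
    _ ≤ C * (N : ℝ) ^ (-min 1 δ) + C * c₀ * (N : ℝ) ^ (-min 1 δ) +
          |I| * (N : ℝ) ^ (-min 1 δ) := by gcongr
    _ = _ := by ring
end

section
/- Let a : ℕ → ℝ be a sequence of distinct positive reals, let ε > 0, and set M = N^{1+ε}, K = N^ε. Let f : ℝ → ℝ be smooth and compactly supported, and let ρ : ℝ → ℝ be smooth, compactly supported, nonnegative with ∫_{-∞}^{∞} ρ(α) dα = 1. Assume there are δ > 0 and c₀ > 0 such that for all N ≥ 1: (A) #{(n,x,y) ∈ ℤ³ : 1 ≤ n ≤ M, 1 ≤ x, y ≤ N, x ≠ y, n·|a(x) − a(y)| < K} ≤ c₀·N^{2−δ}, and (B) the number of integer six-tuples (n₁,n₂,x₁,y₁,x₂,y₂) with 1 ≤ |nᵢ| ≤ M, 1 ≤ xᵢ, yᵢ ≤ N, xᵢ ≠ yᵢ (i = 1,2), and |n₁(a(x₁) − a(y₁)) − n₂(a(x₂)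 − a(y₂))| < K is at most c₀·N^{4−δ}. Then there exist δ' > 0 and c₁ > 0 such that for all N ≥ 1, ∫_{-∞}^{∞} |R₂(f,N)(α) − ∫_{-∞}^{∞} f(x) dx|² · ρ(α) dα ≤ c₁·N^{−δ'}. -/
open MeasureTheory Filter

/-- The count of six-tuples `(n₁,n₂,x₁,y₁,x₂,y₂)` with `1 ≤ |nᵢ| ≤ M`,
`1 ≤ xᵢ ≠ yᵢ ≤ N` and `|n₁(a(x₁) − a(y₁)) − n₂(a(x₂) − a(y₂))| < K`. -/
noncomputable def countB (a : ℕ → ℝ) (M K : ℝ) (N : ℕ) : ℕ :=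
  Set.ncard {t : ℤ × ℤ × ℕ × ℕ × ℕ × ℕ |
    1 ≤ |t.1| ∧ (|t.1| : ℝ) ≤ M ∧
    1 ≤ |t.2.1| ∧ (|t.2.1| : ℝ) ≤ M ∧
    1 ≤ t.2.2.1 ∧ t.2.2.1 ≤ N ∧ 1 ≤ t.2.2.2.1 ∧ t.2.2.2.1 ≤ N ∧ t.2.2.1 ≠ t.2.2.2.1 ∧
    1 ≤ t.2.2.2.2.1 ∧ t.2.2.2.2.1 ≤ N ∧ 1 ≤ t.2.2.2.2.2 ∧ t.2.2.2.2.2 ≤ N ∧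
      t.2.2.2.2.1 ≠ t.2.2.2.2.2 ∧
    |(t.1 : ℝ) * (a t.2.2.1 - a t.2.2.2.1) - (t.2.1 : ℝ) * (a t.2.2.2.2.1 - a t.2.2.2.2.2)| < K}

open scoped FourierTransform

/-- The Fourier transform of a smooth compactly supported function decays rapidly. -/
theorem exists_pow_mul_norm_fourier_le {f : ℝ → ℝ} (hf : ContDiff ℝ (⊤ : ℕ∞) f)
    (hfc : HasCompactSupport f) (k : ℕ) :
    ∃ C : ℝ, 0 < C ∧ ∀ ξ : ℝ, |ξ| ^ k * ‖𝓕 (fun x : ℝ => (f x : ℂ)) ξ‖ ≤ C := by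
  have h1 : HasCompactSupport (fun x : ℝ => (f x : ℂ)) :=
    hfc.comp_left (g := Complex.ofReal) Complex.ofReal_zero
  have h2 : ContDiff ℝ (⊤ : ℕ∞) (fun x : ℝ => (f x : ℂ)) := Complex.ofRealCLM.contDiff.comp hf
  obtain ⟨C, hC, h⟩ := (𝓕 (h1.toSchwartzMap h2)).decay k 0
  refine ⟨C, hC, fun ξ => ?_⟩
  have := h ξ
  rw [norm_iteratedFDeriv_zero] at this
  exact this

theorem fourier_comp_mul_left (g : ℝ → ℂ) {c : ℝ} (hc : 0 < c) (ξ : ℝ) :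
    𝓕 (fun x : ℝ => g (c * x)) ξ = (c : ℂ)⁻¹ * 𝓕 g (ξ / c) := by
  rw [Real.fourier_real_eq_integral_exp_smul, Real.fourier_real_eq_integral_exp_smul]
  have := Measure.integral_comp_mul_left
    (fun v : ℝ => Complex.exp (↑(-2 * Real.pi * v * (ξ / c)) * Complex.I) • g v) c
  rw [abs_of_pos (inv_pos.2 hc), Complex.real_smul, Complex.ofReal_inv] at this
  rw [← this]
  congr 1
  ext v
  congr 4
  field_simp

theorem ofReal_tsum_dilation_eq {f : ℝ → ℝ} (hf : ContDiff ℝ (⊤ : ℕ∞) f)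
    (hfc : HasCompactSupport f) {c : ℝ} (hc : 0 < c) (β : ℝ) :
    ((∑' j : ℤ, f (c * (β + j)) : ℝ) : ℂ) =
      ∑' n : ℤ, (c : ℂ)⁻¹ * 𝓕 (fun x : ℝ => (f x : ℂ)) (n / c) *
        Complex.exp (((2 * Real.pi * (n * β) : ℝ) : ℂ) * Complex.I) := by
  have hm : ContDiff ℝ (⊤ : ℕ∞) (fun x : ℝ => c * x) := contDiff_const.mul contDiff_id
  have h1 : HasCompactSupport (fun x : ℝ => (f (c * x) : ℂ)) :=
    (hfc.comp_homeomorph (Homeomorph.mulLeft₀ c hc.ne')).comp_left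
      (g := Complex.ofReal) Complex.ofReal_zero
  have h2 : ContDiff ℝ (⊤ : ℕ∞) (fun x : ℝ => (f (c * x) : ℂ)) :=
    Complex.ofRealCLM.contDiff.comp (hf.comp hm)
  have h := (h1.toSchwartzMap h2).tsum_eq_tsum_fourier β
  rw [Complex.ofReal_tsum]
  refine Eq.trans ?_ (h.trans (tsum_congr fun n => ?_))
  · exact tsum_congr fun n => rfl
  · rw [fourier_coe_apply, ← fourier_comp_mul_left _ hc]
    congr 2
    push_cast
    ring

/-- Poisson summation for a dilated test function, truncated at frequency `N ^ (1 + ε)`. -/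
theorem exists_norm_tsum_dilation_sub_le {f : ℝ → ℝ} (hf : ContDiff ℝ (⊤ : ℕ∞) f)
    (hfc : HasCompactSupport f) {ε : ℝ} (hε : 0 < ε) :
    ∃ C : ℝ, 0 < C ∧ ∀ N : ℕ, 1 ≤ N → ∀ β : ℝ,
      ‖((∑' j : ℤ, f (N * (β + j)) : ℝ) : ℂ) -
        ∑ n ∈ Finset.Icc (-⌊(N : ℝ) ^ (1 + ε)⌋) ⌊(N : ℝ) ^ (1 + ε)⌋,
          (N : ℂ)⁻¹ * 𝓕 (fun x : ℝ => (f x : ℂ)) (n / N) *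
            Complex.exp (((2 * Real.pi * (n * β) : ℝ) : ℂ) * Complex.I)‖ ≤ C / (N : ℝ) ^ 2 := by
  obtain ⟨p, hp⟩ := exists_nat_ge (3 / ε)
  obtain ⟨C, hC, hdecay⟩ := exists_pow_mul_norm_fourier_le hf hfc (2 + p)
  have hsum : Summable fun n : ℤ => 1 / (n : ℝ) ^ 2 := Real.summable_one_div_int_pow.2 one_lt_two
  have hZ : 0 ≤ ∑' n : ℤ, 1 / (n : ℝ) ^ 2 := tsum_nonneg fun n => by positivity
  refine ⟨C * (∑' n : ℤ, 1 / (n : ℝ) ^ 2 + 1), by positivity, fun N hN β => ?_⟩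
  have hN0 : (0 : ℝ) < N := by exact_mod_cast hN
  have hN1 : (1 : ℝ) ≤ N := by exact_mod_cast hN
  have hP := ofReal_tsum_dilation_eq hf hfc hN0 β
  rw [Complex.ofReal_natCast] at hP
  rw [hP]
  set u : ℤ → ℂ := fun n => (N : ℂ)⁻¹ * 𝓕 (fun x : ℝ => (f x : ℂ)) (n / N) *
            Complex.exp (((2 * Real.pi * (n * β) : ℝ) : ℂ) * Complex.I) with hu
  set S := Finset.Icc (-⌊(N : ℝ) ^ (1 + ε)⌋) ⌊(N : ℝ) ^ (1 + ε)⌋ with hS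
  have hnorm : ∀ n, ‖u n‖ = (N : ℝ)⁻¹ * ‖𝓕 (fun x : ℝ => (f x : ℂ)) (n / N)‖ := fun n => by
    simp only [hu, norm_mul, Complex.norm_exp_ofReal_mul_I, mul_one, norm_inv,
      Complex.norm_natCast]
  have htail : ∀ n, n ∉ S → ‖u n‖ ≤ C / (N : ℝ) ^ 2 * (1 / (n : ℝ) ^ 2) := fun n hn => by
    have hlt : (N : ℝ) ^ (1 + ε) < |(n : ℝ)| := by
      by_contra! hcon
      refine hn (Finset.mem_Icc.2 (abs_le.1 (Int.le_floor.2 ?_)))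
      push_cast
      exact hcon
    have hratio : (N : ℝ) ^ ε ≤ |(n : ℝ) / N| := by
      rw [abs_div, abs_of_pos hN0, le_div_iff₀ hN0]
      rw [Real.rpow_add hN0, Real.rpow_one] at hlt
      linarith
    have hpow : (N : ℝ) ^ 3 ≤ |(n : ℝ) / N| ^ p := by
      calc (N : ℝ) ^ 3 = (N : ℝ) ^ (3 : ℝ) := by norm_cast
        _ ≤ (N : ℝ) ^ (ε * p) := by
            apply Real.rpow_le_rpow_of_exponent_le hN1
            rw [div_le_iff₀ hε] at hp
            linarith
        _ = ((N : ℝ) ^ ε) ^ p := by rw [Real.rpow_mul_natCast hN0.le]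
        _ ≤ _ := by gcongr
    have hn0 : (0 : ℝ) < (n : ℝ) ^ 2 := by
      rw [← sq_abs]
      have : (0 : ℝ) < |(n : ℝ)| := lt_of_le_of_lt (by positivity) hlt
      positivity
    have h := hdecay (n / N)
    rw [pow_add, sq_abs, div_pow] at h
    have h' : (n : ℝ) ^ 2 / N ^ 2 * N ^ 3 * ‖𝓕 (fun x : ℝ => (f x : ℂ)) (n / N)‖ ≤ C :=
      le_trans (by gcongr) h
    rw [hnorm, div_mul_div_comm, mul_one, le_div_iff₀ (by positivity)]
    refine le_trans (le_of_eq ?_) h'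
    field_simp
  have hsu : Summable u := by
    refine Summable.of_norm_bounded_eventually (hsum.mul_left (C / (N : ℝ) ^ 2)) ?_
    filter_upwards [S.finite_toSet.compl_mem_cofinite] with n hn
    exact htail n (by simpa using hn)
  have hsplit := hsu.sum_add_tsum_subtype_compl S
  rw [← hsplit, add_sub_cancel_left]
  have hsub : Summable fun n : {n : ℤ // n ∉ S} => C / (N : ℝ) ^ 2 * (1 / ((n : ℤ) : ℝ) ^ 2) :=
    (hsum.mul_left (C / (N : ℝ) ^ 2)).subtype _
  refine (tsum_of_norm_bounded hsub.hasSum fun n => htail n n.2).trans ?_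
  refine ((hsum.mul_left (C / (N : ℝ) ^ 2)).tsum_subtype_le _ {n | n ∉ S}
    (fun n => by positivity)).trans ?_
  rw [tsum_mul_left, mul_div_right_comm]
  gcongr
  linarith

/-- Mean square of an exponential polynomial against a weight, bounded by its off-diagonal
correlations. -/
theorem integral_norm_sq_sum_exp_mul_le {ι : Type*} (T : Finset ι) (c : ι → ℂ) (l : ι → ℝ)
    {ρ : ℝ → ℝ} (hρ : Integrable ρ) :
    ∫ α : ℝ, ‖∑ t ∈ T, c t * Complex.exp (((2 * Real.pi * (α * l t) : ℝ) : ℂ) * Complex.I)‖ ^ 2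
        * ρ α ≤
      ∑ s ∈ T, ∑ t ∈ T, ‖c s‖ * ‖c t‖ * ‖𝓕 (fun x : ℝ => (ρ x : ℂ)) (l t - l s)‖ := by
  have hexp : ∀ α : ℝ,
      ((‖∑ t ∈ T, c t * Complex.exp (((2 * Real.pi * (α * l t) : ℝ) : ℂ) * Complex.I)‖ ^ 2
        * ρ α : ℝ) : ℂ) = ∑ s ∈ T, ∑ t ∈ T, c s * (starRingEnd ℂ) (c t) *
          (Complex.exp (↑(-2 * Real.pi * α * (l t - l s)) * Complex.I) • (ρ α : ℂ)) := fun α => by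
    rw [Complex.ofReal_mul, Complex.ofReal_pow, ← Complex.mul_conj', map_sum, Finset.sum_mul_sum,
      Finset.sum_mul]
    refine Finset.sum_congr rfl fun s _ => ?_
    rw [Finset.sum_mul]
    refine Finset.sum_congr rfl fun t _ => ?_
    rw [map_mul, ← Complex.exp_conj, map_mul, Complex.conj_ofReal, Complex.conj_I, smul_eq_mul,
      mul_mul_mul_comm, ← Complex.exp_add, mul_assoc]
    congr 3
    push_cast
    ring
  have hphase : ∀ ξ : ℝ, Integrable fun α : ℝ =>
      Complex.exp (↑(-2 * Real.pi * α * ξ) * Complex.I) • (ρ α : ℂ) := fun ξ => by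
    refine hρ.ofReal.bdd_mul (c := 1) ?_ ?_
    · exact (by fun_prop : Continuous fun α : ℝ =>
        Complex.exp (↑(-2 * Real.pi * α * ξ) * Complex.I)).aestronglyMeasurable
    · exact Filter.Eventually.of_forall fun α => (Complex.norm_exp_ofReal_mul_I _).le
  have heq : ((∫ α : ℝ,
      ‖∑ t ∈ T, c t * Complex.exp (((2 * Real.pi * (α * l t) : ℝ) : ℂ) * Complex.I)‖ ^ 2
        * ρ α : ℝ) : ℂ) = ∑ s ∈ T, ∑ t ∈ T, c s * (starRingEnd ℂ) (c t) *
          𝓕 (fun x : ℝ => (ρ x : ℂ)) (l t - l s) := by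
    rw [← integral_complex_ofReal]
    simp_rw [hexp]
    rw [integral_finsetSum _ fun s _ => integrable_finsetSum _ fun t _ =>
      (hphase _).const_mul _]
    refine Finset.sum_congr rfl fun s _ => ?_
    rw [integral_finsetSum _ fun t _ => (hphase _).const_mul _]
    refine Finset.sum_congr rfl fun t _ => ?_
    rw [integral_const_mul, Real.fourier_real_eq_integral_exp_smul]
  refine (le_abs_self _).trans ?_
  rw [← Real.norm_eq_abs, ← Complex.norm_real, heq]
  refine (norm_sum_le _ _).trans (Finset.sum_le_sum fun s _ => (norm_sum_le _ _).trans
    (Finset.sum_le_sum fun t _ => ?_))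
  rw [norm_mul, norm_mul, RCLike.norm_conj]

/-- The nonzero frequencies up to `M`, paired with the ordered pairs of distinct indices up to
`N`. -/
noncomputable def frequencyIndex (M : ℝ) (N : ℕ) : Finset (ℤ × ℕ × ℕ) :=
  (Finset.Icc (-⌊M⌋) ⌊M⌋).erase 0 ×ˢ (Finset.Icc 1 N).offDiag

theorem mem_frequencyIndex {M : ℝ} {N : ℕ} {t : ℤ × ℕ × ℕ} :
    t ∈ frequencyIndex M N ↔ 1 ≤ |t.1| ∧ (|t.1| : ℝ) ≤ M ∧
      (1 ≤ t.2.1 ∧ t.2.1 ≤ N) ∧ (1 ≤ t.2.2 ∧ t.2.2 ≤ N) ∧ t.2.1 ≠ t.2.2 := by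
  have h : (|t.1| : ℝ) ≤ M ↔ -⌊M⌋ ≤ t.1 ∧ t.1 ≤ ⌊M⌋ := by
    rw [← abs_le, Int.le_floor, Int.cast_abs]
  have h' : 1 ≤ |t.1| ↔ t.1 ≠ 0 := ⟨fun h => abs_pos.1 (by omega), Int.one_le_abs⟩
  rw [frequencyIndex, Finset.mem_product, Finset.mem_erase, Finset.mem_offDiag, h, h']
  simp only [Finset.mem_Icc]
  tauto

theorem card_frequencyIndex_le {M : ℝ} (hM : 0 ≤ M) (N : ℕ) :
    ((frequencyIndex M N).card : ℝ) ≤ 2 * M * (N : ℝ) ^ 2 := by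
  have h0 : 0 ≤ ⌊M⌋ := Int.floor_nonneg.2 hM
  rw [frequencyIndex, Finset.card_product, Finset.card_erase_of_mem (by simp [h0]), Int.card_Icc,
    Finset.offDiag_card, Nat.card_Icc, Nat.add_sub_cancel]
  have h1 : (((⌊M⌋ + 1 - -⌊M⌋).toNat - 1 : ℕ) : ℝ) ≤ 2 * M := by
    have : (((⌊M⌋ + 1 - -⌊M⌋).toNat - 1 : ℕ) : ℤ) = 2 * ⌊M⌋ := by omega
    have h2 : (((⌊M⌋ + 1 - -⌊M⌋).toNat - 1 : ℕ) : ℝ) = 2 * (⌊M⌋ : ℝ) := by exact_mod_cast this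
    rw [h2]
    linarith [Int.floor_le M]
  have h2 : ((N * N - N : ℕ) : ℝ) ≤ (N : ℝ) ^ 2 := by
    rw [sq]
    exact_mod_cast Nat.sub_le _ _
  rw [Nat.cast_mul]
  gcongr

theorem card_close_pairs_le_countB (a : ℕ → ℝ) (M K : ℝ) (N : ℕ) :
    (((frequencyIndex M N) ×ˢ (frequencyIndex M N)).filter fun p =>
      |(p.2.1 : ℝ) * (a p.2.2.2 - a p.2.2.1) - (p.1.1 : ℝ) * (a p.1.2.2 - a p.1.2.1)| < K).card ≤
      countB a M K N := by
  rw [← Set.ncard_coe_finset, countB]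
  refine Set.ncard_le_ncard_of_injOn
    (fun p => (p.2.1, p.1.1, p.2.2.2, p.2.2.1, p.1.2.2, p.1.2.1)) ?_ ?_ ?_
  · rintro p hp
    rw [Finset.mem_coe, Finset.mem_filter, Finset.mem_product, mem_frequencyIndex,
      mem_frequencyIndex] at hp
    obtain ⟨⟨⟨h1, h2, h3, h4, h5⟩, h6, h7, h8, h9, h10⟩, h11⟩ := hp
    exact ⟨h6, h7, h1, h2, h9.1, h9.2, h8.1, h8.2, h10.symm, h4.1, h4.2, h3.1, h3.2, h5.symm, h11⟩
  · rintro ⟨⟨n, x, y⟩, n', x', y'⟩ - ⟨⟨m, z, w⟩, m', z', w'⟩ - h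
    simp only [Prod.mk.injEq] at h ⊢
    tauto
  · refine (Finset.finite_toSet (Finset.Icc (-⌊M⌋) ⌊M⌋ ×ˢ Finset.Icc (-⌊M⌋) ⌊M⌋ ×ˢ
      Finset.Icc 1 N ×ˢ Finset.Icc 1 N ×ˢ Finset.Icc 1 N ×ˢ Finset.Icc 1 N)).subset ?_
    rintro t ⟨-, h1, -, h2, h3, h4, h5, h6, -, h7, h8, h9, h10, -, -⟩
    have h : ∀ k : ℤ, (|k| : ℝ) ≤ M → -⌊M⌋ ≤ k ∧ k ≤ ⌊M⌋ := fun k hk => by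
      rwa [← abs_le, Int.le_floor, Int.cast_abs]
    simp only [Finset.coe_product, Set.mem_prod, Finset.coe_Icc, Set.mem_Icc]
    exact ⟨h _ h1, h _ h2, ⟨h3, h4⟩, ⟨h5, h6⟩, ⟨h7, h8⟩, h9, h10⟩

/-- The nonconstant part of the truncated Fourier expansion of the pair correlation function,
without its normalization `N⁻²`. -/
noncomputable def frequencySum (a : ℕ → ℝ) (f : ℝ → ℝ) (M : ℝ) (N : ℕ) (α : ℝ) : ℂ :=
  ∑ t ∈ frequencyIndex M N, 𝓕 (fun x : ℝ => (f x : ℂ)) (t.1 / N) *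
    Complex.exp (((2 * Real.pi * (α * (t.1 * (a t.2.2 - a t.2.1))) : ℝ) : ℂ) * Complex.I)

theorem exists_norm_R2_sub_frequencySum_le (a : ℕ → ℝ) {f : ℝ → ℝ}
    (hf : ContDiff ℝ (⊤ : ℕ∞) f) (hfc : HasCompactSupport f) {ε : ℝ} (hε : 0 < ε) :
    ∃ C : ℝ, 0 < C ∧ ∀ N : ℕ, 1 ≤ N → ∀ α : ℝ,
      ‖((R2 a f N α - ∫ x : ℝ, f x : ℝ) : ℂ) -
        ((N : ℂ) ^ 2)⁻¹ * frequencySum a f ((N : ℝ) ^ (1 + ε)) N α‖ ≤ C / N := by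
  obtain ⟨C, hC, h⟩ := exists_norm_tsum_dilation_sub_le hf hfc hε
  refine ⟨C + ‖((∫ x : ℝ, f x : ℝ) : ℂ)‖, by positivity, fun N hN α => ?_⟩
  have hN0 : (N : ℂ) ≠ 0 := by exact_mod_cast (by omega : N ≠ 0)
  have hN0' : (0 : ℝ) < N := by exact_mod_cast hN
  set M := (N : ℝ) ^ (1 + ε) with hM
  set φ := 𝓕 (fun x : ℝ => (f x : ℂ)) with hφ
  have hφ0 : φ 0 = ((∫ x : ℝ, f x : ℝ) : ℂ) := by
    rw [hφ, Real.fourier_real_eq_integral_exp_smul, ← integral_complex_ofReal]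
    simp
  set O := (Finset.Icc 1 N).offDiag with hO
  set F : ℝ → ℝ := fun β => ∑' j : ℤ, f (N * (β + j)) with hF
  set P : ℝ → ℂ := fun β => ∑ n ∈ Finset.Icc (-⌊M⌋) ⌊M⌋, (N : ℂ)⁻¹ * φ (n / N) *
    Complex.exp (((2 * Real.pi * (n * β) : ℝ) : ℂ) * Complex.I) with hP
  have hR : ((R2 a f N α : ℝ) : ℂ) = (N : ℂ)⁻¹ * ∑ p ∈ O, (F (α * a p.2 - α * a p.1) : ℂ) := by
    have hO' : O = (Finset.Icc 1 N ×ˢ Finset.Icc 1 N).filter fun p => p.1 ≠ p.2 := by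
      ext p
      simp [hO, and_assoc]
    rw [R2, hO', Finset.sum_filter, Finset.sum_product]
    push_cast
    rw [one_div]
    congr 1
    refine Finset.sum_congr rfl fun m _ => Finset.sum_congr rfl fun n _ => ?_
    split_ifs <;> simp [hF]
  have hT : ((N : ℂ) ^ 2)⁻¹ * frequencySum a f M N α =
      (N : ℂ)⁻¹ * ∑ p ∈ O, (P (α * a p.2 - α * a p.1) - (N : ℂ)⁻¹ * φ 0) := by
    rw [frequencySum, frequencyIndex, Finset.sum_product_right, sq, mul_inv, mul_assoc,
      Finset.mul_sum]
    congr 1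
    refine Finset.sum_congr rfl fun p _ => ?_
    have h0 : (0 : ℤ) ∈ Finset.Icc (-⌊M⌋) ⌊M⌋ := by
      have : 0 ≤ ⌊M⌋ := Int.floor_nonneg.2 (by positivity)
      simp [this]
    simp only [hP]
    rw [← Finset.add_sum_erase _ _ h0, Finset.mul_sum]
    simp only [Int.cast_zero, zero_div, zero_mul, mul_zero, Complex.ofReal_zero, Complex.exp_zero,
      mul_one, add_sub_cancel_left]
    refine Finset.sum_congr rfl fun n _ => ?_
    rw [← mul_assoc, mul_left_comm α, mul_sub α]
  have hcard : (O.card : ℂ) = (N : ℂ) ^ 2 - N := by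
    rw [hO, Finset.offDiag_card, Nat.card_Icc, Nat.add_sub_cancel,
      Nat.cast_sub (Nat.le_mul_self N), Nat.cast_mul, sq]
  have hkey : ((R2 a f N α - ∫ x : ℝ, f x : ℝ) : ℂ) - ((N : ℂ) ^ 2)⁻¹ * frequencySum a f M N α =
      (N : ℂ)⁻¹ * ∑ p ∈ O, ((F (α * a p.2 - α * a p.1) : ℂ) - P (α * a p.2 - α * a p.1)) -
        (N : ℂ)⁻¹ * φ 0 := by
    rw [hT, Complex.ofReal_sub, hR, ← hφ0, Finset.sum_sub_distrib, Finset.sum_sub_distrib,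
      Finset.sum_const, nsmul_eq_mul, hcard]
    field_simp
    ring
  have hcard' : (O.card : ℝ) ≤ (N : ℝ) ^ 2 := by
    rw [hO, Finset.offDiag_card, Nat.card_Icc, Nat.add_sub_cancel, sq]
    exact_mod_cast Nat.sub_le _ _
  have hsum : ‖∑ p ∈ O, ((F (α * a p.2 - α * a p.1) : ℂ) - P (α * a p.2 - α * a p.1))‖ ≤ C := by
    refine (norm_sum_le_of_le O fun p _ => h N hN (α * a p.2 - α * a p.1)).trans ?_
    rw [Finset.sum_const, nsmul_eq_mul]
    calc (O.card : ℝ) * (C / (N : ℝ) ^ 2) ≤ (N : ℝ) ^ 2 * (C / (N : ℝ) ^ 2) := by gcongr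
      _ = C := by field_simp
  rw [hkey]
  refine (norm_sub_le _ _).trans ?_
  rw [norm_mul, norm_mul, norm_inv, Complex.norm_natCast, hφ0, ← mul_add, div_eq_inv_mul]
  gcongr

theorem exists_integral_norm_sq_frequencySum_le (a : ℕ → ℝ) {ε : ℝ} (hε : 0 < ε)
    {f : ℝ → ℝ} (hf : ContDiff ℝ (⊤ : ℕ∞) f) (hfc : HasCompactSupport f)
    {ρ : ℝ → ℝ} (hρ : ContDiff ℝ (⊤ : ℕ∞) ρ) (hρc : HasCompactSupport ρ)
    {δ c₀ : ℝ} (hc₀ : 0 < c₀)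
    (hB : ∀ N : ℕ, 1 ≤ N →
      (countB a ((N : ℝ) ^ ((1 : ℝ) + ε)) ((N : ℝ) ^ ε) N : ℝ) ≤ c₀ * (N : ℝ) ^ ((4 : ℝ) - δ)) :
    ∃ C : ℝ, 0 < C ∧ ∀ N : ℕ, 1 ≤ N →
      ∫ α : ℝ, ‖frequencySum a f ((N : ℝ) ^ (1 + ε)) N α‖ ^ 2 * ρ α ≤
        C * (N : ℝ) ^ (4 - min δ 1) := by
  obtain ⟨k, hk⟩ := exists_nat_ge ((3 + 2 * ε) / ε)
  obtain ⟨b, hb, hfb⟩ := exists_pow_mul_norm_fourier_le hf hfc 0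
  obtain ⟨D, hD, hρD⟩ := exists_pow_mul_norm_fourier_le hρ hρc 0
  obtain ⟨E, hE, hρE⟩ := exists_pow_mul_norm_fourier_le hρ hρc k
  simp only [pow_zero, one_mul] at hfb hρD
  refine ⟨b ^ 2 * (D * c₀ + 4 * E), by positivity, fun N hN => ?_⟩
  have hN0 : (0 : ℝ) < N := by exact_mod_cast hN
  have hN1 : (1 : ℝ) ≤ N := by exact_mod_cast hN
  set M := (N : ℝ) ^ (1 + ε) with hM
  set K := (N : ℝ) ^ ε with hK
  set T := frequencyIndex M N with hT
  set l : ℤ × ℕ × ℕ → ℝ := fun t => t.1 * (a t.2.2 - a t.2.1) with hl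
  set r : ℝ := (N : ℝ) ^ (-(3 + 2 * ε)) with hr
  have hfar : ∀ ξ : ℝ, K ≤ |ξ| → ‖𝓕 (fun x : ℝ => (ρ x : ℂ)) ξ‖ ≤ E * r := fun ξ hξ => by
    have h1 : (N : ℝ) ^ (3 + 2 * ε) ≤ |ξ| ^ k := by
      calc (N : ℝ) ^ (3 + 2 * ε) ≤ (N : ℝ) ^ (ε * k) := by
            apply Real.rpow_le_rpow_of_exponent_le hN1
            rw [div_le_iff₀ hε] at hk
            linarith
        _ = K ^ k := by rw [Real.rpow_mul_natCast hN0.le]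
        _ ≤ _ := by gcongr
    have h2 : (N : ℝ) ^ (3 + 2 * ε) * ‖𝓕 (fun x : ℝ => (ρ x : ℂ)) ξ‖ ≤ E :=
      le_trans (by gcongr) (hρE ξ)
    rw [hr, Real.rpow_neg hN0.le, ← div_eq_mul_inv, le_div_iff₀ (by positivity)]
    linarith
  have hterm : ∀ p : (ℤ × ℕ × ℕ) × (ℤ × ℕ × ℕ),
      ‖𝓕 (fun x : ℝ => (f x : ℂ)) (p.1.1 / N)‖ * ‖𝓕 (fun x : ℝ => (f x : ℂ)) (p.2.1 / N)‖ *
        ‖𝓕 (fun x : ℝ => (ρ x : ℂ)) (l p.2 - l p.1)‖ ≤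
      b ^ 2 * ((if |l p.2 - l p.1| < K then D else 0) + E * r) := fun p => by
    have h1 : ‖𝓕 (fun x : ℝ => (ρ x : ℂ)) (l p.2 - l p.1)‖ ≤
        (if |l p.2 - l p.1| < K then D else 0) + E * r := by
      split_ifs with h
      · have : 0 ≤ E * r := by positivity
        linarith [hρD (l p.2 - l p.1)]
      · rw [zero_add]
        exact hfar _ (not_lt.1 h)
    rw [sq]
    gcongr
    · exact hfb _
    · exact hfb _
  have hcount : (((T ×ˢ T).filter fun p => |l p.2 - l p.1| < K).card : ℝ) ≤
      c₀ * (N : ℝ) ^ (4 - δ) :=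
    le_trans (by exact_mod_cast card_close_pairs_le_countB a M K N) (hB N hN)
  have hcard : ((T ×ˢ T).card : ℝ) * r ≤ 4 * (N : ℝ) ^ (3 : ℝ) := by
    have h1 : (T.card : ℝ) ≤ 2 * (N : ℝ) ^ (3 + ε) := by
      refine (card_frequencyIndex_le (by positivity) N).trans (le_of_eq ?_)
      rw [mul_assoc, hM, ← Real.rpow_natCast, ← Real.rpow_add hN0]
      congr 2
      push_cast
      ring
    rw [Finset.card_product, Nat.cast_mul]
    calc (T.card : ℝ) * T.card * r ≤ (2 * (N : ℝ) ^ (3 + ε)) * (2 * (N : ℝ) ^ (3 + ε)) * r := by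
          gcongr
      _ = 4 * ((N : ℝ) ^ (3 + ε) * (N : ℝ) ^ (3 + ε) * r) := by ring
      _ = _ := by
          rw [hr, ← Real.rpow_add hN0, ← Real.rpow_add hN0]
          congr 2
          ring
  have hp1 : (N : ℝ) ^ (4 - δ) ≤ (N : ℝ) ^ (4 - min δ 1) :=
    Real.rpow_le_rpow_of_exponent_le hN1 (by linarith [min_le_left δ 1])
  have hp2 : (N : ℝ) ^ (3 : ℝ) ≤ (N : ℝ) ^ (4 - min δ 1) :=
    Real.rpow_le_rpow_of_exponent_le hN1 (by linarith [min_le_right δ 1])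
  refine (integral_norm_sq_sum_exp_mul_le T (fun t => 𝓕 (fun x : ℝ => (f x : ℂ)) (t.1 / N)) l
    (hρ.continuous.integrable_of_hasCompactSupport hρc)).trans ?_
  rw [← Finset.sum_product']
  refine (Finset.sum_le_sum fun p _ => hterm p).trans ?_
  rw [← Finset.mul_sum, Finset.sum_add_distrib, ← Finset.sum_filter, Finset.sum_const,
    Finset.sum_const, nsmul_eq_mul, nsmul_eq_mul, mul_assoc (b ^ 2)]
  gcongr
  calc _ = (((T ×ˢ T).filter fun p => |l p.2 - l p.1| < K).card : ℝ) * D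
        + E * (((T ×ˢ T).card : ℝ) * r) := by ring
    _ ≤ (c₀ * (N : ℝ) ^ (4 - min δ 1)) * D + E * (4 * (N : ℝ) ^ (4 - min δ 1)) := by
        refine add_le_add (mul_le_mul_of_nonneg_right ?_ hD.le)
          (mul_le_mul_of_nonneg_left ?_ hE.le)
        · exact hcount.trans (by gcongr)
        · exact hcard.trans (by gcongr)
    _ = _ := by ring

/-- (Mean-square of the pair correlation around the Poisson limit.)
Under the counting conditions (A) and (B) with `M = N^{1+ε}`, `K = N^ε`, the smooth
average of `|R₂(f,N) − ∫f|²` is `O(N^{−δ'})`. -/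
theorem mean_square_pair_correlation
    (a : ℕ → ℝ)
    (hpos : ∀ x : ℕ, 1 ≤ x → 0 < a x)
    (hdist : ∀ x y : ℕ, 1 ≤ x → 1 ≤ y → x ≠ y → a x ≠ a y)
    (ε : ℝ) (hε : 0 < ε)
    (f : ℝ → ℝ) (hf : ContDiff ℝ (⊤ : ℕ∞) f) (hfc : HasCompactSupport f)
    (ρ : ℝ → ℝ) (hρ : ContDiff ℝ (⊤ : ℕ∞) ρ) (hρc : HasCompactSupport ρ)
    (hρ0 : ∀ x : ℝ, 0 ≤ ρ x) (hρ1 : ∫ x : ℝ, ρ x = 1)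
    (δ c₀ : ℝ) (hδ : 0 < δ) (hc₀ : 0 < c₀)
    (hA : ∀ N : ℕ, 1 ≤ N →
      (countA a ((N : ℝ) ^ ((1 : ℝ) + ε)) ((N : ℝ) ^ ε) N : ℝ) ≤ c₀ * (N : ℝ) ^ ((2 : ℝ) - δ))
    (hB : ∀ N : ℕ, 1 ≤ N →
      (countB a ((N : ℝ) ^ ((1 : ℝ) + ε)) ((N : ℝ) ^ ε) N : ℝ) ≤ c₀ * (N : ℝ) ^ ((4 : ℝ) - δ)) :
    ∃ δ' : ℝ, 0 < δ' ∧ ∃ c₁ : ℝ, 0 < c₁ ∧ ∀ N : ℕ, 1 ≤ N →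
      (∫ α : ℝ, |R2 a f N α - ∫ x : ℝ, f x| ^ 2 * ρ α) ≤ c₁ * (N : ℝ) ^ (-δ') := by
  obtain ⟨C, hC, h1⟩ := exists_norm_R2_sub_frequencySum_le a hf hfc hε
  obtain ⟨B, hB', h2⟩ := exists_integral_norm_sq_frequencySum_le a hε hf hfc hρ hρc hc₀ hB
  refine ⟨min δ 1, lt_min hδ one_pos, 2 * C ^ 2 + 2 * B, by positivity, fun N hN => ?_⟩
  have hN0 : (0 : ℝ) < N := by exact_mod_cast hN
  have hN1 : (1 : ℝ) ≤ N := by exact_mod_cast hN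
  set G := frequencySum a f ((N : ℝ) ^ (1 + ε)) N with hG
  have hGc : Continuous G := by
    unfold G frequencySum
    fun_prop
  have hρi : Integrable ρ := hρ.continuous.integrable_of_hasCompactSupport hρc
  have hGi : Integrable fun α => ‖G α‖ ^ 2 * ρ α :=
    ((hGc.norm.pow 2).mul hρ.continuous).integrable_of_hasCompactSupport hρc.mul_left
  have hpt : ∀ α, |R2 a f N α - ∫ x : ℝ, f x| ^ 2 * ρ α ≤
      2 * (C / N) ^ 2 * ρ α + 2 * ((N : ℝ) ^ 4)⁻¹ * (‖G α‖ ^ 2 * ρ α) := fun α => by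
    have h3 : |R2 a f N α - ∫ x : ℝ, f x| ≤ C / N + ((N : ℝ) ^ 2)⁻¹ * ‖G α‖ := by
      rw [← Real.norm_eq_abs, ← Complex.norm_real]
      refine (norm_le_norm_sub_add _ (((N : ℂ) ^ 2)⁻¹ * G α)).trans
        (add_le_add (h1 N hN α) (le_of_eq ?_))
      rw [norm_mul, norm_inv, norm_pow, Complex.norm_natCast]
    calc |R2 a f N α - ∫ x : ℝ, f x| ^ 2 * ρ α
        ≤ (C / N + ((N : ℝ) ^ 2)⁻¹ * ‖G α‖) ^ 2 * ρ α := by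
          have := hρ0 α
          gcongr
      _ ≤ (2 * ((C / N) ^ 2 + (((N : ℝ) ^ 2)⁻¹ * ‖G α‖) ^ 2)) * ρ α :=
          mul_le_mul_of_nonneg_right add_sq_le (hρ0 α)
      _ = _ := by
          rw [mul_pow, inv_pow, ← pow_mul]
          ring
  refine (integral_mono_of_nonneg (Eventually.of_forall fun α => by
    have := hρ0 α
    positivity) ((hρi.const_mul _).add (hGi.const_mul _)) (Eventually.of_forall hpt)).trans ?_
  simp only [Pi.add_apply]
  rw [integral_add (hρi.const_mul _) (hGi.const_mul _), integral_const_mul, integral_const_mul,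
    hρ1, mul_one, add_mul]
  refine add_le_add ?_ ?_
  · rw [div_pow, mul_div_assoc', div_eq_mul_inv, ← Real.rpow_natCast (N : ℝ),
      ← Real.rpow_neg hN0.le]
    gcongr
    push_cast
    linarith [min_le_right δ 1]
  · refine (mul_le_mul_of_nonneg_left (h2 N hN) (by positivity)).trans (le_of_eq ?_)
    rw [sub_eq_add_neg, Real.rpow_add hN0, show (4 : ℝ) = ((4 : ℕ) : ℝ) by norm_num,
      Real.rpow_natCast]
    field_simp
end

section
/- Let a : ℕ → ℝ be a sequence of distinct positive reals, let ε > 0 be sufficiently small, and set M = N^{1+ε}, K = N^ε. Let f : ℝ → ℝ be smooth and compactly supported, and let ρ : ℝ → ℝ be smooth, compactly supported, nonnegative with ∫_{-∞}^{∞} ρ(α) dα = 1. Then there exists a constant c > 0 (depending on f, ρ, ε, and a) such that for all N ≥ 1, the variance Var(N) = ∫_{-∞}^{∞} |R₂(f,N)(α) − ⟨R₂(f,N)⟩|² · ρ(α) dα satisfies Var(N) ≤ c·(#S(N)/N⁴ + 1/N⁴), where ⟨R₂(f,N)⟩ = ∫_{-∞}^{∞} R₂(f,N)(α)·ρ(α)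 dα, and S(N) is the set of integer six-tuples (n₁,n₂,x₁,y₁,x₂,y₂) with 1 ≤ |nᵢ| ≤ M, 1 ≤ xᵢ, yᵢ ≤ N, xᵢ ≠ yᵢ (i = 1,2), satisfying |n₁(a(x₁) − a(y₁)) − n₂(a(x₂) − a(y₂))| < K. -/
open MeasureTheory Filter

section

open scoped FourierTransform ComplexConjugate

/-- The Fourier transform of a test function decays faster than any power. -/
lemma exists_fourier_decay {f : ℝ → ℝ} (hf : ContDiff ℝ (⊤ : ℕ∞) f) (hfc : HasCompactSupport f)
    (A : ℕ) : ∃ C : ℝ, 0 < C ∧ ∀ x : ℝ, |x| ^ A * ‖𝓕 (fun y => (f y : ℂ)) x‖ ≤ C := by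
  have h₁ : HasCompactSupport (fun y => (f y : ℂ)) := hfc.comp_left Complex.ofReal_zero
  have h₂ : ContDiff ℝ (⊤ : ℕ∞) (fun y => (f y : ℂ)) := Complex.ofRealCLM.contDiff.comp hf
  obtain ⟨C, hC, h⟩ := (𝓕 (h₁.toSchwartzMap h₂)).decay A 0
  refine ⟨C, hC, fun x => ?_⟩
  have := h x
  rw [norm_iteratedFDeriv_zero, Real.norm_eq_abs] at this
  exact this

/-- Poisson summation for a dilated test function. -/
lemma tsum_comp_mul_eq_tsum_fourier {f : ℝ → ℝ} (hf : ContDiff ℝ (⊤ : ℕ∞) f)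
    (hfc : HasCompactSupport f) {b : ℝ} (hb : 0 < b) (x : ℝ) :
    ((∑' j : ℤ, f (b * (x + j)) : ℝ) : ℂ) =
      (b : ℂ)⁻¹ * ∑' k : ℤ, 𝓕 (fun y => (f y : ℂ)) (k / b) * (𝐞 (k * x) : ℂ) := by
  have h₁ : HasCompactSupport (fun y => (f (b * y) : ℂ)) := by
    have : HasCompactSupport (fun y => f (b * y)) :=
      hfc.comp_homeomorph (Homeomorph.mulLeft₀ b hb.ne')
    exact this.comp_left Complex.ofReal_zero
  have h₂ : ContDiff ℝ (⊤ : ℕ∞) (fun y => (f (b * y) : ℂ)) :=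
    Complex.ofRealCLM.contDiff.comp (hf.comp (contDiff_const.mul contDiff_id))
  have h := SchwartzMap.tsum_eq_tsum_fourier (h₁.toSchwartzMap h₂) x
  have hF (w : ℝ) : 𝓕 (fun y => (f (b * y) : ℂ)) w
      = (b : ℂ)⁻¹ * 𝓕 (fun y => (f y : ℂ)) (w / b) := by
    rw [Real.fourier_real_eq, Real.fourier_real_eq]
    have := Measure.integral_comp_mul_left
      (fun v : ℝ => 𝐞 (-(v * (w / b))) • (f v : ℂ)) b
    rw [abs_of_pos (inv_pos.2 hb)] at this
    rw [← Complex.ofReal_inv, ← smul_eq_mul, Complex.coe_smul, ← this]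
    congr 1 with v
    congr 3
    field_simp
  rw [Complex.ofReal_tsum, ← tsum_mul_left]
  simp only [SchwartzMap.fourier_coe] at h
  refine Eq.trans h ?_
  congr 1 with k
  have h3 : (fourier k (x : UnitAddCircle)) = (𝐞 (k * x) : ℂ) := by
    rw [fourier_coe_apply, Real.fourierChar_apply]
    push_cast
    congr 1
    ring
  rw [h3, ← mul_assoc, ← hF]
  rfl

/-- The second moment of an exponential polynomial against `ρ`, bounded through `𝓕 ρ`. -/
lemma integral_norm_sq_expSum_le {ι : Type*} (S : Finset ι) (w : ι → ℂ) (l : ι → ℝ)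
    {ρ : ℝ → ℝ} (hρ : Continuous ρ) (hρc : HasCompactSupport ρ) :
    ∫ α : ℝ, ‖∑ s ∈ S, w s * (𝐞 (l s * α) : ℂ)‖ ^ 2 * ρ α ≤
      ∑ s ∈ S, ∑ t ∈ S, ‖w s‖ * ‖w t‖ * ‖𝓕 (fun y => (ρ y : ℂ)) (l s - l t)‖ := by
  have hint (u : ℂ) (v : ℝ) : Integrable (fun α : ℝ => u * ((𝐞 (-(α * v)) : ℂ) * (ρ α : ℂ))) := by
    apply Continuous.integrable_of_hasCompactSupport
    · have := Real.continuous_fourierChar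
      fun_prop
    · have : HasCompactSupport (fun y => (ρ y : ℂ)) := hρc.comp_left Complex.ofReal_zero
      exact (this.mul_left).mul_left
  have key : ((∫ α : ℝ, ‖∑ s ∈ S, w s * (𝐞 (l s * α) : ℂ)‖ ^ 2 * ρ α : ℝ) : ℂ) =
      ∑ s ∈ S, ∑ t ∈ S, conj (w s) * w t * 𝓕 (fun y => (ρ y : ℂ)) (l s - l t) := by
    have hpt (α : ℝ) : ((‖∑ s ∈ S, w s * (𝐞 (l s * α) : ℂ)‖ ^ 2 * ρ α : ℝ) : ℂ) =
        ∑ s ∈ S, ∑ t ∈ S, conj (w s) * w t * ((𝐞 (-(α * (l s - l t))) : ℂ) * (ρ α : ℂ)) := by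
      have hchar (s t : ι) : (𝐞 (-(α * (l s - l t))) : ℂ)
          = conj (𝐞 (l s * α) : ℂ) * (𝐞 (l t * α) : ℂ) := by
        rw [← Circle.coe_inv_eq_conj, ← AddChar.map_neg_eq_inv, ← Circle.coe_mul,
          ← AddChar.map_add_eq_mul]
        congr 2
        ring
      push_cast
      rw [← Complex.conj_mul', map_sum, Finset.sum_mul_sum, Finset.sum_mul]
      refine Finset.sum_congr rfl fun s _ => ?_
      rw [Finset.sum_mul]
      refine Finset.sum_congr rfl fun t _ => ?_
      rw [hchar, map_mul]
      ring
    rw [← integral_complex_ofReal]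
    simp_rw [hpt]
    rw [integral_finsetSum _ (fun s _ => integrable_finsetSum _ fun t _ => hint _ _)]
    refine Finset.sum_congr rfl fun s _ => ?_
    rw [integral_finsetSum _ (fun t _ => hint _ _)]
    refine Finset.sum_congr rfl fun t _ => ?_
    rw [integral_const_mul, Real.fourier_real_eq]
    rfl
  calc _ ≤ ‖((∫ α : ℝ, ‖∑ s ∈ S, w s * (𝐞 (l s * α) : ℂ)‖ ^ 2 * ρ α : ℝ) : ℂ)‖ := by
        rw [Complex.norm_real]; exact le_abs_self _
    _ ≤ _ := by
        rw [key]
        refine (norm_sum_le _ _).trans (Finset.sum_le_sum fun s _ => ?_)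
        refine (norm_sum_le _ _).trans (Finset.sum_le_sum fun t _ => ?_)
        simp

/-- Among all constants, the mean minimises the second moment. -/
lemma integral_sq_sub_mean_le {X ρ : ℝ → ℝ} (hX : Continuous X) (hρ : Continuous ρ)
    (hρc : HasCompactSupport ρ) (hρ1 : ∫ x, ρ x = 1) (c : ℝ) :
    ∫ α, |X α - ∫ β, X β * ρ β| ^ 2 * ρ α ≤ ∫ α, |X α - c| ^ 2 * ρ α := by
  set m := ∫ β, X β * ρ β with hm
  have hi {g : ℝ → ℝ} (hg : Continuous g) : Integrable (fun α => g α * ρ α) :=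
    (hg.mul hρ).integrable_of_hasCompactSupport hρc.mul_left
  have h1 : ∫ α, (|X α - c| ^ 2 * ρ α - |X α - m| ^ 2 * ρ α)
      = ∫ α, (2 * (m - c) * (X α * ρ α) + (c ^ 2 - m ^ 2) * ρ α) := by
    congr 1 with α
    simp only [sq_abs]
    ring
  rw [integral_sub (hi (by fun_prop)) (hi (by fun_prop)),
    integral_add ((hi hX).const_mul _) ((hρ.integrable_of_hasCompactSupport hρc).const_mul _),
    integral_const_mul, integral_const_mul, hρ1, ← hm] at h1
  nlinarith [sq_nonneg (m - c)]

lemma summable_fourier_div {f : ℝ → ℝ} (hf : ContDiff ℝ (⊤ : ℕ∞) f) (hfc : HasCompactSupport f)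
    {b : ℝ} (hb : 0 < b) :
    Summable fun k : ℤ => ‖𝓕 (fun y => (f y : ℂ)) (k / b)‖ := by
  obtain ⟨C, -, h⟩ := exists_fourier_decay hf hfc 2
  refine Summable.of_norm_bounded_eventually
    ((Real.summable_one_div_int_pow.2 one_lt_two).mul_left (C * b ^ 2)) ?_
  refine (Set.finite_singleton (0 : ℤ)).subset fun k hk => ?_
  by_contra hk0
  refine hk ?_
  have hk1 : (0 : ℝ) < (k : ℝ) ^ 2 := by
    have : (k : ℝ) ≠ 0 := by exact_mod_cast hk0
    positivity
  have := h (k / b)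
  rw [sq_abs, div_pow] at this
  change ‖‖𝓕 (fun y => (f y : ℂ)) (k / b)‖‖ ≤ C * b ^ 2 * (1 / (k : ℝ) ^ 2)
  rw [norm_norm, mul_one_div, le_div_iff₀ hk1]
  calc _ = (k : ℝ) ^ 2 / b ^ 2 * ‖𝓕 (fun y => (f y : ℂ)) (k / b)‖ * b ^ 2 := by field_simp
    _ ≤ C * b ^ 2 := by gcongr

/-- The nonzero integers of absolute value at most `M`. -/
noncomputable def nonzeroFreqs (M : ℝ) : Finset ℤ := (Finset.Icc (-⌊M⌋) ⌊M⌋).erase 0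

lemma mem_nonzeroFreqs {M : ℝ} {k : ℤ} : k ∈ nonzeroFreqs M ↔ 1 ≤ |k| ∧ |(k : ℝ)| ≤ M := by
  have h : 1 ≤ |k| ↔ k ≠ 0 := ⟨fun h => by rintro rfl; simp at h, Int.one_le_abs⟩
  rw [nonzeroFreqs, Finset.mem_erase, h, Finset.mem_Icc, ← abs_le,
    Int.le_floor, Int.cast_abs]

lemma card_nonzeroFreqs_le {M : ℝ} (hM : 0 ≤ M) : ((nonzeroFreqs M).card : ℝ) ≤ 2 * M := by
  have h0 : 0 ≤ ⌊M⌋ := Int.floor_nonneg.2 hM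
  have h : ((nonzeroFreqs M).card : ℤ) = 2 * ⌊M⌋ := by
    rw [nonzeroFreqs, Finset.card_erase_of_mem (by simp [h0]), Int.card_Icc]
    omega
  have h' : ((nonzeroFreqs M).card : ℝ) = 2 * (⌊M⌋ : ℝ) := by exact_mod_cast h
  linarith [Int.floor_le M]

/-- Removing the constant term and the frequencies up to `M = b * K` from the Poisson dual sum
leaves a remainder that is small in terms of `K`. -/
lemma norm_tsum_sub_truncation_le {φ : ℝ → ℂ} {b K C : ℝ} {A : ℕ} (hb : 0 < b) (hK : 0 < K)
    (hs : Summable fun k : ℤ => ‖φ (k / b)‖) (hC : ∀ x, |x| ^ (A + 2) * ‖φ x‖ ≤ C) (x : ℝ) :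
    ‖(∑' k : ℤ, φ (k / b) * (𝐞 (k * x) : ℂ)) - φ 0
        - ∑ k ∈ nonzeroFreqs (b * K), φ (k / b) * (𝐞 (k * x) : ℂ)‖
      ≤ C * b ^ 2 / K ^ A * ∑' k : ℤ, 1 / (k : ℝ) ^ 2 := by
  have hC0 : 0 ≤ C := le_trans (by positivity) (hC 0)
  have hsum : Summable fun k : ℤ => φ (k / b) * (𝐞 (k * x) : ℂ) := by
    refine Summable.of_norm (hs.congr fun k => ?_)
    rw [norm_mul, Circle.norm_coe, mul_one]
  have h0 : (0 : ℤ) ∉ nonzeroFreqs (b * K) := by simp [nonzeroFreqs]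
  rw [← hsum.sum_add_tsum_subtype_compl (insert 0 (nonzeroFreqs (b * K))), Finset.sum_insert h0]
  have hz : φ ((0 : ℤ) / b) * (𝐞 ((0 : ℤ) * x) : ℂ) = φ 0 := by simp
  rw [hz, add_assoc, add_sub_cancel_left, add_sub_cancel_left]
  have hZ := (Real.summable_one_div_int_pow (p := 2)).2 one_lt_two
  have hZ' := hZ.subtype {k : ℤ | k ∉ insert 0 (nonzeroFreqs (b * K))}
  refine (tsum_of_norm_bounded (hZ'.hasSum.mul_left (C * b ^ 2 / K ^ A)) ?_).trans ?_
  · rintro ⟨k, hk⟩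
    have hk' : ¬ (k = 0 ∨ k ∈ nonzeroFreqs (b * K)) := fun h => hk (Finset.mem_insert.2 h)
    rw [mem_nonzeroFreqs] at hk'
    push Not at hk'
    have hkM := hk'.2 (Int.one_le_abs hk'.1)
    have hk0 : (0 : ℝ) < |(k : ℝ)| := abs_pos.2 (by exact_mod_cast hk'.1)
    have h1 : K ≤ |(k : ℝ) / b| := by
      rw [abs_div, abs_of_pos hb, le_div_iff₀ hb]
      linarith
    have h2 : K ^ A * |(k : ℝ) / b| ^ 2 * ‖φ (k / b)‖ ≤ C := by
      refine le_trans ?_ (hC (k / b))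
      rw [pow_add]
      gcongr
    rw [sq_abs, div_pow] at h2
    have hk2 : (0 : ℝ) < (k : ℝ) ^ 2 := by rw [← sq_abs]; positivity
    have hkne : (k : ℝ) ≠ 0 := by exact_mod_cast hk'.1
    rw [norm_mul, Circle.norm_coe, mul_one]
    simp only [Function.comp_apply]
    calc ‖φ (k / b)‖ = (K ^ A * ((k : ℝ) ^ 2 / b ^ 2) * ‖φ (k / b)‖)
          * (b ^ 2 / K ^ A * (1 / (k : ℝ) ^ 2)) := by field_simp
      _ ≤ C * (b ^ 2 / K ^ A * (1 / (k : ℝ) ^ 2)) := by gcongr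
      _ = _ := by ring
  · gcongr
    exact hZ.tsum_subtype_le _ _ (fun k => by positivity)

/-- The Fourier expansion of the pair correlation function. -/
lemma R2_eq_fourier (a : ℕ → ℝ) {f : ℝ → ℝ} (hf : ContDiff ℝ (⊤ : ℕ∞) f)
    (hfc : HasCompactSupport f) {N : ℕ} (hN : 1 ≤ N) (α : ℝ) :
    (R2 a f N α : ℂ) = ((N : ℂ) ^ 2)⁻¹ * ∑ p ∈ (Finset.Icc 1 N).offDiag,
      ∑' k : ℤ, 𝓕 (fun y => (f y : ℂ)) (k / (N : ℝ)) * (𝐞 (k * ((a p.2 - a p.1) * α)) : ℂ) := by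
  have hN' : (0 : ℝ) < N := by exact_mod_cast hN
  have hoff : (Finset.Icc 1 N).offDiag
      = (Finset.Icc 1 N ×ˢ Finset.Icc 1 N).filter (fun p => p.1 ≠ p.2) := by
    ext p
    simp [Finset.mem_offDiag, and_assoc]
  rw [R2, ← Finset.sum_product', ← Finset.sum_filter, ← hoff, Finset.mul_sum, Complex.ofReal_sum,
    Finset.mul_sum]
  refine Finset.sum_congr rfl fun p _ => ?_
  rw [Complex.ofReal_mul]
  have := tsum_comp_mul_eq_tsum_fourier hf hfc hN' ((a p.2 - a p.1) * α)
  rw [show (fun j : ℤ => f (N * (α * a p.2 - α * a p.1 + j)))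
    = fun j : ℤ => f (N * ((a p.2 - a p.1) * α + j)) by ext j; congr 2; ring, this]
  simp only [Complex.ofReal_div, Complex.ofReal_one, Complex.ofReal_natCast]
  ring

lemma continuous_R2 (a : ℕ → ℝ) {f : ℝ → ℝ} (hf : ContDiff ℝ (⊤ : ℕ∞) f)
    (hfc : HasCompactSupport f) {N : ℕ} (hN : 1 ≤ N) : Continuous (R2 a f N) := by
  have hN' : (0 : ℝ) < N := by exact_mod_cast hN
  have h : Continuous fun α => (R2 a f N α : ℂ) := by
    simp_rw [R2_eq_fourier a hf hfc hN]
    refine continuous_const.mul (continuous_finsetSum _ fun p _ => ?_)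
    refine continuous_tsum (fun k => ?_) (summable_fourier_div hf hfc hN') fun k x => ?_
    · have := Real.continuous_fourierChar
      fun_prop
    · rw [norm_mul, Circle.norm_coe, mul_one]
  exact Complex.continuous_re.comp h

lemma card_filter_le_countB (a : ℕ → ℝ) (M K : ℝ) (N : ℕ) :
    (((nonzeroFreqs M ×ˢ (Finset.Icc 1 N).offDiag) ×ˢ
      (nonzeroFreqs M ×ˢ (Finset.Icc 1 N).offDiag)).filter fun q =>
        |(q.1.1 : ℝ) * (a q.1.2.2 - a q.1.2.1) - (q.2.1 : ℝ) * (a q.2.2.2 - a q.2.2.1)| < K).card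
      ≤ countB a M K N := by
  rw [countB, ← Set.ncard_coe_finset]
  refine Set.ncard_le_ncard_of_injOn
    (fun q => (q.1.1, q.2.1, q.1.2.2, q.1.2.1, q.2.2.2, q.2.2.1)) ?_ ?_ ?_
  · rintro ⟨⟨k₁, m₁, n₁⟩, k₂, m₂, n₂⟩ hq
    simp only [Finset.coe_filter, Finset.mem_product, mem_nonzeroFreqs, Finset.mem_offDiag,
      Finset.mem_Icc, Set.mem_ofPred_eq] at hq ⊢
    obtain ⟨⟨⟨⟨h1, h2⟩, ⟨h3, h4⟩, ⟨h5, h6⟩, h7⟩, ⟨h8, h9⟩, ⟨h10, h11⟩, ⟨h12, h13⟩, h14⟩, h15⟩ := hq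
    exact ⟨h1, h2, h8, h9, h5, h6, h3, h4, h7.symm, h12, h13, h10, h11, h14.symm, h15⟩
  · rintro ⟨⟨k₁, m₁, n₁⟩, k₂, m₂, n₂⟩ - ⟨⟨k₁', m₁', n₁'⟩, k₂', m₂', n₂'⟩ - h
    simp only [Prod.mk.injEq] at h ⊢
    tauto
  · refine ((nonzeroFreqs M ×ˢ nonzeroFreqs M ×ˢ Finset.Icc 1 N ×ˢ Finset.Icc 1 N ×ˢ
      Finset.Icc 1 N ×ˢ Finset.Icc 1 N).finite_toSet).subset ?_
    rintro ⟨k₁, k₂, x₁, y₁, x₂, y₂⟩ h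
    simp only [Finset.coe_product, Set.mem_prod, Finset.mem_coe, mem_nonzeroFreqs,
      Finset.mem_Icc, Set.mem_ofPred_eq] at h ⊢
    tauto

/-- The variance bound with a truncation parameter `K` that is at most `N`, but of which some
fixed power exceeds `N ^ 8`. -/
lemma exists_variance_le (a : ℕ → ℝ) {f : ℝ → ℝ} (hf : ContDiff ℝ (⊤ : ℕ∞) f)
    (hfc : HasCompactSupport f) {ρ : ℝ → ℝ} (hρ : ContDiff ℝ (⊤ : ℕ∞) ρ)
    (hρc : HasCompactSupport ρ) (hρ0 : ∀ x, 0 ≤ ρ x) (hρ1 : ∫ x, ρ x = 1) (A : ℕ) :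
    ∃ c : ℝ, 0 < c ∧ ∀ N : ℕ, 1 ≤ N → ∀ K : ℝ, 0 < K → K ≤ N → (N : ℝ) ^ 8 ≤ K ^ A →
      (∫ α : ℝ, |R2 a f N α - ∫ β : ℝ, R2 a f N β * ρ β| ^ 2 * ρ α) ≤
        c * ((countB a (N * K) K N : ℝ) / (N : ℝ) ^ 4 + 1 / (N : ℝ) ^ 4) := by
  obtain ⟨C₁, hC₁, hφ₀⟩ := exists_fourier_decay hf hfc 0
  obtain ⟨C₂, hC₂, hφ⟩ := exists_fourier_decay hf hfc (A + 2)
  obtain ⟨D₀, hD₀, hψ₀⟩ := exists_fourier_decay hρ hρc 0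
  obtain ⟨D₁, hD₁, hψ⟩ := exists_fourier_decay hρ hρc A
  set φ := 𝓕 (fun y => (f y : ℂ))
  set ψ := 𝓕 (fun y => (ρ y : ℂ))
  simp only [pow_zero, one_mul] at hφ₀ hψ₀
  set Z : ℝ := ∑' k : ℤ, 1 / (k : ℝ) ^ 2
  have hZ : 0 ≤ Z := tsum_nonneg fun k => by positivity
  refine ⟨2 * (C₁ ^ 2 * D₀) + 2 * (C₁ ^ 2 * D₁ * 4) + 2 * (C₂ * Z) ^ 2, by positivity,
    fun N hN K hK hKN hNK => ?_⟩
  have hN1 : (1 : ℝ) ≤ N := by exact_mod_cast hN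
  have hN0 : (0 : ℝ) < N := by linarith
  have hKA : 0 < K ^ A := by positivity
  set P := (Finset.Icc 1 N).offDiag with hP
  have hPcard : (P.card : ℝ) ≤ (N : ℝ) ^ 2 := by
    have : P.card ≤ N ^ 2 := by
      rw [hP, Finset.offDiag_card, Nat.card_Icc, sq]
      exact Nat.sub_le _ _
    exact_mod_cast this
  set S := nonzeroFreqs (N * K) ×ˢ P with hS
  have hScard : (S.card : ℝ) ≤ 2 * (N : ℝ) ^ 4 := by
    rw [hS, Finset.card_product, Nat.cast_mul]
    calc _ ≤ (2 * (N * K)) * (N : ℝ) ^ 2 := by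
          gcongr
          exact card_nonzeroFreqs_le (by positivity)
      _ ≤ (2 * (N * N)) * (N : ℝ) ^ 2 := by gcongr
      _ = _ := by ring
  set l : ℤ × ℕ × ℕ → ℝ := fun s => s.1 * (a s.2.2 - a s.2.1) with hl
  set w : ℤ × ℕ × ℕ → ℂ := fun s => φ (s.1 / (N : ℝ)) with hw
  set E : ℝ → ℂ := fun α => ∑ s ∈ S, w s * (𝐞 (l s * α) : ℂ) with hE
  have hsum := summable_fourier_div hf hfc hN0
  -- approximation of the centred correlation by a finite exponential sum
  set c₀ : ℂ := ((N : ℂ) ^ 2)⁻¹ * (P.card * φ 0) with hc₀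
  have happrox (α : ℝ) : ‖(R2 a f N α : ℂ) - c₀ - ((N : ℂ) ^ 2)⁻¹ * E α‖
      ≤ ((N : ℝ) ^ 2)⁻¹ * (C₂ * Z) := by
    have hEα : E α = ∑ p ∈ P, ∑ k ∈ nonzeroFreqs (N * K),
        φ (k / (N : ℝ)) * (𝐞 (k * ((a p.2 - a p.1) * α)) : ℂ) := by
      rw [hE]
      simp only [hS, hw, hl]
      rw [Finset.sum_product_right]
      simp only [mul_assoc]
    have hid : (R2 a f N α : ℂ) - c₀ - ((N : ℂ) ^ 2)⁻¹ * E α = ((N : ℂ) ^ 2)⁻¹ * ∑ p ∈ P,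
        ((∑' k : ℤ, φ (k / (N : ℝ)) * (𝐞 (k * ((a p.2 - a p.1) * α)) : ℂ)) - φ 0
          - ∑ k ∈ nonzeroFreqs (N * K),
            φ (k / (N : ℝ)) * (𝐞 (k * ((a p.2 - a p.1) * α)) : ℂ)) := by
      rw [R2_eq_fourier a hf hfc hN, Finset.sum_sub_distrib, Finset.sum_sub_distrib, ← hEα, hc₀,
        Finset.sum_const, nsmul_eq_mul]
      ring
    rw [hid, norm_mul, norm_inv, norm_pow, Complex.norm_natCast]
    gcongr
    calc _ ≤ ∑ p ∈ P, C₂ * N ^ 2 / K ^ A * Z := (norm_sum_le _ _).trans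
          (Finset.sum_le_sum fun p _ => norm_tsum_sub_truncation_le hN0 hK hsum hφ _)
      _ = P.card * (C₂ * N ^ 2 / K ^ A * Z) := by rw [Finset.sum_const, nsmul_eq_mul]
      _ ≤ N ^ 2 * (C₂ * N ^ 2 / K ^ A * Z) := by gcongr
      _ = C₂ * Z * (N ^ 4 / K ^ A) := by ring
      _ ≤ C₂ * Z * 1 := by
          gcongr
          rw [div_le_one hKA]
          exact (pow_le_pow_right₀ hN1 (by norm_num)).trans hNK
      _ = _ := mul_one _
  have hsq (α : ℝ) : |R2 a f N α - c₀.re| ^ 2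
      ≤ ((N : ℝ) ^ 4)⁻¹ * (2 * ‖E α‖ ^ 2 + 2 * (C₂ * Z) ^ 2) := by
    have h1 : |R2 a f N α - c₀.re| ≤ ((N : ℝ) ^ 2)⁻¹ * (‖E α‖ + C₂ * Z) := by
      calc |R2 a f N α - c₀.re| = |((R2 a f N α : ℂ) - c₀).re| := by simp
        _ ≤ ‖(R2 a f N α : ℂ) - c₀‖ := Complex.abs_re_le_norm _
        _ ≤ ‖(R2 a f N α : ℂ) - c₀ - ((N : ℂ) ^ 2)⁻¹ * E α‖ + ‖((N : ℂ) ^ 2)⁻¹ * E α‖ :=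
            norm_le_norm_sub_add _ _
        _ ≤ ((N : ℝ) ^ 2)⁻¹ * (C₂ * Z) + ((N : ℝ) ^ 2)⁻¹ * ‖E α‖ := by
            gcongr
            · exact happrox α
            · rw [norm_mul, norm_inv, norm_pow, Complex.norm_natCast]
        _ = _ := by ring
    calc _ ≤ (((N : ℝ) ^ 2)⁻¹ * (‖E α‖ + C₂ * Z)) ^ 2 := by gcongr
      _ = ((N : ℝ) ^ 4)⁻¹ * (‖E α‖ + C₂ * Z) ^ 2 := by ring
      _ ≤ _ := by
        gcongr
        nlinarith [sq_nonneg (‖E α‖ - C₂ * Z)]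
  have hEcont : Continuous E := by
    have := Real.continuous_fourierChar
    fun_prop
  have hint {g : ℝ → ℝ} (hg : Continuous g) : Integrable (fun α => g α * ρ α) :=
    (hg.mul hρ.continuous).integrable_of_hasCompactSupport hρc.mul_left
  -- the second moment of the exponential sum
  have hψle (x : ℝ) : ‖ψ x‖ ≤ (if |x| < K then D₀ else 0) + D₁ / (N : ℝ) ^ 8 := by
    split_ifs with hx
    · exact (hψ₀ x).trans (le_add_of_nonneg_right (by positivity))
    · rw [zero_add, le_div_iff₀ (by positivity)]
      calc ‖ψ x‖ * N ^ 8 ≤ ‖ψ x‖ * |x| ^ A := by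
            gcongr
            exact hNK.trans (by gcongr; exact not_lt.1 hx)
        _ = |x| ^ A * ‖ψ x‖ := mul_comm _ _
        _ ≤ D₁ := hψ x
  have hmoment : ∫ α, ‖E α‖ ^ 2 * ρ α
      ≤ C₁ ^ 2 * (D₀ * countB a (N * K) K N + D₁ * 4) := by
    calc _ ≤ ∑ s ∈ S, ∑ t ∈ S, ‖w s‖ * ‖w t‖ * ‖ψ (l s - l t)‖ :=
          integral_norm_sq_expSum_le S w l hρ.continuous hρc
      _ ≤ ∑ s ∈ S, ∑ t ∈ S,
            C₁ * C₁ * ((if |l s - l t| < K then D₀ else 0) + D₁ / (N : ℝ) ^ 8) := by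
          gcongr with s _ t _
          · exact hφ₀ _
          · exact hφ₀ _
          · exact hψle _
      _ = C₁ ^ 2 * (D₀ * ((S ×ˢ S).filter fun q => |l q.1 - l q.2| < K).card
            + D₁ * ((S.card : ℝ) ^ 2 / N ^ 8)) := by
          rw [← Finset.sum_product', ← Finset.mul_sum, Finset.sum_add_distrib,
            ← Finset.sum_filter, Finset.sum_const, Finset.sum_const, Finset.card_product,
            nsmul_eq_mul, nsmul_eq_mul]
          push_cast
          ring
      _ ≤ _ := by
          gcongr
          · exact card_filter_le_countB a (N * K) K N
          · rw [div_le_iff₀ (by positivity)]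
            calc (S.card : ℝ) ^ 2 ≤ (2 * (N : ℝ) ^ 4) ^ 2 := by gcongr
              _ = _ := by ring
  have hR := continuous_R2 a hf hfc hN
  calc _ ≤ ∫ α, |R2 a f N α - c₀.re| ^ 2 * ρ α :=
        integral_sq_sub_mean_le hR hρ.continuous hρc hρ1 _
    _ ≤ ∫ α, ((N : ℝ) ^ 4)⁻¹ * (2 * (‖E α‖ ^ 2 * ρ α) + 2 * (C₂ * Z) ^ 2 * ρ α) := by
        refine integral_mono (hint (by fun_prop)) ?_ fun α => ?_
        · exact (((hint (by fun_prop)).const_mul _).add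
            ((hρ.continuous.integrable_of_hasCompactSupport hρc).const_mul _)).const_mul _
        · calc _ ≤ ((N : ℝ) ^ 4)⁻¹ * (2 * ‖E α‖ ^ 2 + 2 * (C₂ * Z) ^ 2) * ρ α :=
                mul_le_mul_of_nonneg_right (hsq α) (hρ0 α)
            _ = _ := by ring
    _ = ((N : ℝ) ^ 4)⁻¹ * (2 * (∫ α, ‖E α‖ ^ 2 * ρ α) + 2 * (C₂ * Z) ^ 2) := by
        rw [integral_const_mul, integral_add ((hint (by fun_prop)).const_mul _)
          ((hρ.continuous.integrable_of_hasCompactSupport hρc).const_mul _), integral_const_mul,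
          integral_const_mul, hρ1, mul_one]
    _ ≤ ((N : ℝ) ^ 4)⁻¹ * (2 * (C₁ ^ 2 * (D₀ * countB a (N * K) K N + D₁ * 4))
          + 2 * (C₂ * Z) ^ 2) := by gcongr
    _ ≤ ((N : ℝ) ^ 4)⁻¹ * ((2 * (C₁ ^ 2 * D₀) + 2 * (C₁ ^ 2 * D₁ * 4) + 2 * (C₂ * Z) ^ 2) *
          (countB a (N * K) K N + 1)) := by
        gcongr
        have h0 : (0 : ℝ) ≤ countB a (N * K) K N := Nat.cast_nonneg _
        have h1 : 0 ≤ C₁ ^ 2 * D₀ := by positivity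
        have h2 : 0 ≤ C₁ ^ 2 * D₁ * 4 * countB a (N * K) K N := by positivity
        have h3 : 0 ≤ (C₂ * Z) ^ 2 * countB a (N * K) K N := by positivity
        linarith
    _ = _ := by ring

end

/-- (Variance bound in terms of the Diophantine count.) For `ε > 0`
sufficiently small, the variance of the smoothed pair correlation is
`≪ #S(N)/N⁴ + 1/N⁴`, where `S(N)` uses `M = N^{1+ε}` and `K = N^ε`. -/
theorem variance_bounded_by_counting
    (a : ℕ → ℝ)
    (hpos : ∀ x : ℕ, 1 ≤ x → 0 < a x)
    (hdist : ∀ x y : ℕ, 1 ≤ x → 1 ≤ y → x ≠ y → a x ≠ a y)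
    (f : ℝ → ℝ) (hf : ContDiff ℝ (⊤ : ℕ∞) f) (hfc : HasCompactSupport f)
    (ρ : ℝ → ℝ) (hρ : ContDiff ℝ (⊤ : ℕ∞) ρ) (hρc : HasCompactSupport ρ)
    (hρ0 : ∀ x : ℝ, 0 ≤ ρ x) (hρ1 : ∫ x : ℝ, ρ x = 1) :
    ∃ ε₀ : ℝ, 0 < ε₀ ∧ ∀ ε : ℝ, 0 < ε → ε < ε₀ →
      ∃ c : ℝ, 0 < c ∧ ∀ N : ℕ, 1 ≤ N →
        (∫ α : ℝ, |R2 a f N α - ∫ β : ℝ, R2 a f N β * ρ β| ^ 2 * ρ α) ≤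
          c * ((countB a ((N : ℝ) ^ ((1 : ℝ) + ε)) ((N : ℝ) ^ ε) N : ℝ) / (N : ℝ) ^ 4
            + 1 / (N : ℝ) ^ 4) := by
  refine ⟨1, one_pos, fun ε hε hε1 => ?_⟩
  obtain ⟨c, hc, h⟩ := exists_variance_le a hf hfc hρ hρc hρ0 hρ1 ⌈8 / ε⌉₊
  refine ⟨c, hc, fun N hN => ?_⟩
  have hN1 : (1 : ℝ) ≤ N := by exact_mod_cast hN
  have hN0 : (0 : ℝ) < N := by linarith
  rw [Real.rpow_add hN0, Real.rpow_one]
  refine h N hN _ (Real.rpow_pos_of_pos hN0 _) ?_ ?_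
  · simpa using Real.rpow_le_rpow_of_exponent_le hN1 hε1.le
  · rw [← Real.rpow_mul_natCast hN0.le, ← Real.rpow_natCast]
    refine Real.rpow_le_rpow_of_exponent_le hN1 ?_
    have := (div_le_iff₀ hε).1 (Nat.le_ceil (8 / ε))
    push_cast
    linarith
end

section
/- Let θ : ℕ → ℝ be a sequence of real numbers (viewed modulo one). Suppose there is a strictly increasing sequence of positive integers N₁ < N₂ < ... with lim_{m→∞} N_{m+1}/N_m = 1, such that for every smooth compactly supported f : ℝ → ℝ one has lim_{m→∞} R₂(f,N_m) = ∫_{-∞}^{∞} f(x) dx, where R₂(f,N) = (1/N) · Σ_{1 ≤ j ≠ k ≤ N} Σ_{i ∈ ℤ} f(N·(θ_j − θ_k + i)). Then for every smooth compactly supported f : ℝ → ℝ, lim_{N→∞} R₂(f,N) = ∫_{-∞}^{∞} f(x) dx, where the limit is over all positive integers N. -/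
open MeasureTheory Filter

/-- The pair correlation function
`R₂(f,N) = (1/N) · Σ_{1 ≤ j ≠ k ≤ N} Σ_{i ∈ ℤ} f(N·(θ_j − θ_k + i))`. -/
noncomputable def R2pc (θ : ℕ → ℝ) (f : ℝ → ℝ) (N : ℕ) : ℝ :=
  (1 / (N : ℝ)) * ∑ j ∈ Finset.Icc 1 N, ∑ k ∈ Finset.Icc 1 N,
    if j ≠ k then (∑' i : ℤ, f ((N : ℝ) * (θ j - θ k + (i : ℝ)))) else 0

/-- The unnormalised pair correlation sum over indices up to `n`, at scale `s`. -/
noncomputable def pairSum (θ : ℕ → ℝ) (f : ℝ → ℝ) (n : ℕ) (s : ℝ) : ℝ :=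
  ∑ j ∈ Finset.Icc 1 n, ∑ k ∈ Finset.Icc 1 n,
    if j ≠ k then (∑' i : ℤ, f (s * (θ j - θ k + (i : ℝ)))) else 0

lemma R2pc_eq_pairSum_div (θ : ℕ → ℝ) (f : ℝ → ℝ) (N : ℕ) :
    R2pc θ f N = pairSum θ f N N / N := by
  rw [R2pc, pairSum, one_div, inv_mul_eq_div]

lemma summable_comp_int_translates {f : ℝ → ℝ} (hf : HasCompactSupport f) {s : ℝ} (hs : s ≠ 0)
    (x : ℝ) : Summable fun i : ℤ => f (s * (x + (i : ℝ))) := by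
  have h : HasCompactSupport fun i : ℤ => f (s * (x + (i : ℝ))) := by
    refine hf.comp_isClosedEmbedding (g := fun i : ℤ => s * (x + (i : ℝ))) ?_
    exact ((Homeomorph.mulLeft₀ s hs).isClosedEmbedding.comp
      (Homeomorph.addLeft x).isClosedEmbedding).comp Int.isClosedEmbedding_coe_real
  refine summable_of_hasFiniteSupport ?_
  exact (isCompact_iff_finite.mp h).subset (subset_tsupport _)

lemma pairSum_mono_fun {θ : ℕ → ℝ} {f g : ℝ → ℝ} (hf : HasCompactSupport f)
    (hg : HasCompactSupport g) {s t : ℝ} (hs : s ≠ 0) (ht : t ≠ 0)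
    (h : ∀ x, f (s * x) ≤ g (t * x)) (n : ℕ) : pairSum θ f n s ≤ pairSum θ g n t := by
  refine Finset.sum_le_sum fun j _ => Finset.sum_le_sum fun k _ => ?_
  split_ifs
  · exact (summable_comp_int_translates hf hs _).tsum_le_tsum (fun i => h _)
      (summable_comp_int_translates hg ht _)
  · exact le_rfl

lemma pairSum_mono_index {θ : ℕ → ℝ} {f : ℝ → ℝ} (hf : ∀ x, 0 ≤ f x) {m n : ℕ} (hmn : m ≤ n)
    (s : ℝ) : pairSum θ f m s ≤ pairSum θ f n s := by
  have hterm : ∀ j k : ℕ,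
      0 ≤ if j ≠ k then (∑' i : ℤ, f (s * (θ j - θ k + (i : ℝ)))) else 0 := by
    intro j k
    split_ifs
    · exact tsum_nonneg fun _ => hf _
    · exact le_rfl
  have hsub := Finset.Icc_subset_Icc_right (a := 1) hmn
  calc pairSum θ f m s
      ≤ ∑ j ∈ Finset.Icc 1 m, ∑ k ∈ Finset.Icc 1 n,
          if j ≠ k then (∑' i : ℤ, f (s * (θ j - θ k + (i : ℝ)))) else 0 :=
        Finset.sum_le_sum fun j _ =>
          Finset.sum_le_sum_of_subset_of_nonneg hsub fun k _ _ => hterm j k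
    _ ≤ pairSum θ f n s :=
        Finset.sum_le_sum_of_subset_of_nonneg hsub fun j _ _ =>
          Finset.sum_nonneg fun k _ => hterm j k

lemma pairSum_add_const_mul {θ : ℕ → ℝ} {f g : ℝ → ℝ} (hf : HasCompactSupport f)
    (hg : HasCompactSupport g) (c : ℝ) (n : ℕ) {s : ℝ} (hs : s ≠ 0) :
    pairSum θ (fun x => f x + c * g x) n s = pairSum θ f n s + c * pairSum θ g n s := by
  simp only [pairSum, Finset.mul_sum, ← Finset.sum_add_distrib]
  refine Finset.sum_congr rfl fun j _ => Finset.sum_congr rfl fun k _ => ?_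
  split_ifs
  · rw [(summable_comp_int_translates hf hs _).tsum_add
      ((summable_comp_int_translates hg hs _).mul_left c), tsum_mul_left]
  · simp

lemma hasCompactSupport_add_const_mul {f g : ℝ → ℝ} (hf : HasCompactSupport f)
    (hg : HasCompactSupport g) (c : ℝ) : HasCompactSupport fun x => f x + c * g x :=
  hf.add (hg.mul_left (f := fun _ => c))

/-- A smooth compactly supported function has a smooth compactly supported majorant which also
controls its variation under dilations by factors close to one. -/
lemma exists_smooth_majorant {f : ℝ → ℝ} (hf : ContDiff ℝ (⊤ : ℕ∞) f)
    (hfc : HasCompactSupport f) :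
    ∃ (g : ℝ → ℝ) (C : ℝ), ContDiff ℝ (⊤ : ℕ∞) g ∧ HasCompactSupport g ∧ (∀ x, 0 ≤ g x) ∧
      (∀ x, |f x| ≤ C * g x) ∧
      ∀ r : ℝ, 1 / 2 ≤ r → ∀ x, |f (r * x) - f x| ≤ C * |r - 1| * g x := by
  obtain ⟨K, hK⟩ := hf.lipschitzWith_of_hasCompactSupport hfc (by simp)
  obtain ⟨B, hB⟩ := hfc.exists_bound_of_continuous hf.continuous
  obtain ⟨A, hA0, hA⟩ := hfc.isBounded.exists_pos_norm_le
  let g : ContDiffBump (0 : ℝ) := ⟨2 * A, 2 * A + 1, by positivity, by linarith⟩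
  have hf0 : ∀ x, A < |x| → f x = 0 := fun x hx =>
    image_eq_zero_of_notMem_tsupport fun h => absurd (hA x h) (by simpa using hx)
  have hg1 : ∀ x, |x| ≤ 2 * A → g x = 1 := fun x hx =>
    g.one_of_mem_closedBall (by simpa [g] using hx)
  have hB0 : 0 ≤ B := (norm_nonneg _).trans (hB 0)
  have hC : 0 ≤ B + K * (2 * A) := by positivity
  refine ⟨g, B + K * (2 * A), g.contDiff, g.hasCompactSupport, fun x => g.nonneg,
    fun x => ?_, fun r hr x => ?_⟩
  · rcases le_or_gt |x| (2 * A) with hx | hx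
    · rw [hg1 x hx]
      have := hB x
      rw [Real.norm_eq_abs] at this
      have : 0 ≤ K * (2 * A) := by positivity
      linarith
    · rw [hf0 x (by linarith), abs_zero]
      exact mul_nonneg hC g.nonneg
  · rcases le_or_gt |x| (2 * A) with hx | hx
    · rw [hg1 x hx, mul_one]
      have h := hK.dist_le_mul (r * x) x
      rw [Real.dist_eq, Real.dist_eq, show r * x - x = x * (r - 1) by ring, abs_mul] at h
      calc |f (r * x) - f x| ≤ K * (|x| * |r - 1|) := h
        _ ≤ K * (2 * A * |r - 1|) := by gcongr
        _ ≤ (B + K * (2 * A)) * |r - 1| := by nlinarith [mul_nonneg hB0 (abs_nonneg (r - 1))]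
    · rw [hf0 x (by linarith), hf0 (r * x), sub_zero, abs_zero]
      · exact mul_nonneg (mul_nonneg hC (abs_nonneg _)) g.nonneg
      · rw [abs_mul, abs_of_nonneg (by linarith : (0 : ℝ) ≤ r)]
        nlinarith

lemma exists_bracketing_of_strictMono {u : ℕ → ℕ} (hu : StrictMono u) :
    ∃ φ : ℕ → ℕ, Tendsto φ atTop atTop ∧ ∀ᶠ N in atTop, u (φ N) ≤ N ∧ N < u (φ N + 1) := by
  refine ⟨fun N => Nat.findGreatest (fun m => u m ≤ N) N, ?_, ?_⟩
  · refine tendsto_atTop.mpr fun b => ?_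
    filter_upwards [eventually_ge_atTop (u b)] with N hN
    exact Nat.le_findGreatest (hu.le_apply.trans hN) hN
  · filter_upwards [eventually_ge_atTop (u 0)] with N hN
    refine ⟨Nat.findGreatest_spec (P := fun m => u m ≤ N) (Nat.zero_le N) hN, ?_⟩
    by_contra! h
    exact absurd (Nat.le_findGreatest (P := fun m => u m ≤ N) (hu.le_apply.trans h) h)
      (by omega)

/-- Convergence of the pair correlation along a slowly growing subsequence gives convergence
for a nonnegative test function. -/
lemma tendsto_R2pc_of_subsequence_of_nonneg {θ : ℕ → ℝ} {Nseq : ℕ → ℕ}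
    (hmono : StrictMono Nseq) (hposseq : ∀ m : ℕ, 0 < Nseq m)
    (hratio : Tendsto (fun m : ℕ => (Nseq (m + 1) : ℝ) / (Nseq m : ℝ)) atTop (nhds 1))
    {f g : ℝ → ℝ} {C a b : ℝ} (hf0 : ∀ x, 0 ≤ f x)
    (hf : HasCompactSupport f) (hg : HasCompactSupport g)
    (hfg : ∀ r : ℝ, 1 / 2 ≤ r → ∀ x, |f (r * x) - f x| ≤ C * |r - 1| * g x)
    (hfa : Tendsto (fun m : ℕ => R2pc θ f (Nseq m)) atTop (nhds a))
    (hgb : Tendsto (fun m : ℕ => R2pc θ g (Nseq m)) atTop (nhds b)) :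
    Tendsto (fun N : ℕ => R2pc θ f N) atTop (nhds a) := by
  obtain ⟨φ, hφ, hbr⟩ := exists_bracketing_of_strictMono hmono
  have hφ1 : Tendsto (fun N => φ N + 1) atTop atTop :=
    (tendsto_add_atTop_nat 1).comp hφ
  have hratio' := hratio.comp hφ
  have hpos : ∀ m, (0 : ℝ) < Nseq m := fun m => by exact_mod_cast hposseq m
  have hlow : Tendsto (fun N : ℕ => (N : ℝ) / Nseq (φ N)) atTop (nhds 1) := by
    refine tendsto_of_tendsto_of_tendsto_of_le_of_le' tendsto_const_nhds hratio' ?_ ?_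
    · filter_upwards [hbr] with N hN
      rw [le_div_iff₀ (hpos _), one_mul]
      exact_mod_cast hN.1
    · filter_upwards [hbr] with N hN
      exact div_le_div_of_nonneg_right (by exact_mod_cast hN.2.le) (hpos _).le
  have hupp : Tendsto (fun N : ℕ => (N : ℝ) / Nseq (φ N + 1)) atTop (nhds 1) := by
    have h := hlow.div hratio' one_ne_zero
    rw [div_one] at h
    refine h.congr fun N => ?_
    have h1 := (hpos (φ N)).ne'
    have h2 := (hpos (φ N + 1)).ne'
    simp only [Pi.div_apply, Function.comp_apply]
    field_simp
  have hlim : ∀ (ψ : ℕ → ℕ) (c : ℝ), Tendsto ψ atTop atTop →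
      Tendsto (fun N : ℕ => (N : ℝ) / Nseq (ψ N)) atTop (nhds 1) →
      Tendsto (fun N : ℕ => (R2pc θ f (Nseq (ψ N)) +
        c * |(N : ℝ) / Nseq (ψ N) - 1| * R2pc θ g (Nseq (ψ N))) / ((N : ℝ) / Nseq (ψ N)))
        atTop (nhds a) := by
    intro ψ c hψ hr
    have h := ((hfa.comp hψ).add (((hr.sub_const 1).abs.const_mul c).mul
      (hgb.comp hψ))).div hr one_ne_zero
    simpa [Function.comp_def, Pi.div_def] using h
  have hpt : ∀ N M : ℕ, 0 < N → 0 < M → ∀ c : ℝ,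
      (R2pc θ f M + c * |(N : ℝ) / M - 1| * R2pc θ g M) / ((N : ℝ) / M) =
        pairSum θ (fun x => f x + c * |(N : ℝ) / M - 1| * g x) M M / N := by
    intro N M hN hM c
    have hN' : (N : ℝ) ≠ 0 := by positivity
    have hM' : (M : ℝ) ≠ 0 := by positivity
    rw [pairSum_add_const_mul hf hg _ _ hM', R2pc_eq_pairSum_div, R2pc_eq_pairSum_div]
    field_simp
  have hdil : ∀ N M : ℕ, 0 < M → ∀ x : ℝ, (N : ℝ) * x = (N : ℝ) / M * (M * x) := by
    intro N M hM x
    field_simp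
  refine tendsto_of_tendsto_of_tendsto_of_le_of_le' (hlim φ (-C) hφ hlow)
    (hlim (fun N => φ N + 1) C hφ1 hupp) ?_ ?_
  · filter_upwards [hbr, hlow.eventually_const_le (show (1 / 2 : ℝ) < 1 by norm_num),
      eventually_gt_atTop 0] with N hN hr hN0
    have hM := hposseq (φ N)
    have hN0' : (0 : ℝ) < N := by exact_mod_cast hN0
    rw [hpt N _ hN0 hM, R2pc_eq_pairSum_div]
    refine div_le_div_of_nonneg_right ?_ hN0'.le
    refine (pairSum_mono_fun (hasCompactSupport_add_const_mul hf hg _) hf (hpos _).ne' hN0'.ne'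
      (fun x => ?_) _).trans (pairSum_mono_index hf0 hN.1 _)
    rw [hdil N _ hM x]
    linarith [(abs_le.mp (hfg _ hr (Nseq (φ N) * x))).1]
  · filter_upwards [hbr, hupp.eventually_const_le (show (1 / 2 : ℝ) < 1 by norm_num),
      eventually_gt_atTop 0] with N hN hr hN0
    have hM := hposseq (φ N + 1)
    have hN0' : (0 : ℝ) < N := by exact_mod_cast hN0
    rw [hpt N _ hN0 hM, R2pc_eq_pairSum_div]
    refine div_le_div_of_nonneg_right ?_ hN0'.le
    refine (pairSum_mono_index hf0 hN.2.le _).trans (pairSum_mono_fun hf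
      (hasCompactSupport_add_const_mul hf hg _) hN0'.ne' (hpos _).ne' (fun x => ?_) _)
    rw [hdil N _ hM x]
    linarith [(abs_le.mp (hfg _ hr (Nseq (φ N + 1) * x))).2]

/-- If the pair correlation converges to the Poisson limit along a
strictly increasing sequence `N₁ < N₂ < ⋯` of positive integers with `N_{m+1}/N_m → 1`
for all smooth compactly supported test functions, then it converges along the full
sequence of positive integers. -/
theorem pair_correlation_full_of_subsequence
    (θ : ℕ → ℝ) (Nseq : ℕ → ℕ)
    (hmono : StrictMono Nseq) (hposseq : ∀ m : ℕ, 0 < Nseq m)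
    (hratio : Tendsto (fun m : ℕ => (Nseq (m + 1) : ℝ) / (Nseq m : ℝ)) atTop (nhds 1))
    (hsub : ∀ f : ℝ → ℝ, ContDiff ℝ (⊤ : ℕ∞) f → HasCompactSupport f →
      Tendsto (fun m : ℕ => R2pc θ f (Nseq m)) atTop (nhds (∫ x : ℝ, f x))) :
    ∀ f : ℝ → ℝ, ContDiff ℝ (⊤ : ℕ∞) f → HasCompactSupport f →
      Tendsto (fun N : ℕ => R2pc θ f N) atTop (nhds (∫ x : ℝ, f x)) := by
  have hnonneg : ∀ f : ℝ → ℝ, ContDiff ℝ (⊤ : ℕ∞) f → HasCompactSupport f → (∀ x, 0 ≤ f x) →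
      Tendsto (fun N : ℕ => R2pc θ f N) atTop (nhds (∫ x : ℝ, f x)) := by
    intro f hf hfc hf0
    obtain ⟨g, C, hg, hgc, -, -, hfg⟩ := exists_smooth_majorant hf hfc
    exact tendsto_R2pc_of_subsequence_of_nonneg hmono hposseq hratio hf0 hfc hgc hfg
      (hsub f hf hfc) (hsub g hg hgc)
  intro f hf hfc
  obtain ⟨g, C, hg, hgc, hg0, hfg, -⟩ := exists_smooth_majorant hf hfc
  have hsum := hnonneg (fun x => f x + C * g x) (hf.add (contDiff_const.mul hg))
    (hasCompactSupport_add_const_mul hfc hgc C) fun x => by linarith [(abs_le.mp (hfg x)).1]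
  have hlim := hsum.sub ((hnonneg g hg hgc hg0).const_mul C)
  rw [integral_add (hf.continuous.integrable_of_hasCompactSupport hfc)
    ((hg.continuous.integrable_of_hasCompactSupport hgc).const_mul C),
    integral_const_mul, add_sub_cancel_right] at hlim
  refine hlim.congr' ?_
  filter_upwards [eventually_gt_atTop 0] with N hN
  have hN' : (N : ℝ) ≠ 0 := by positivity
  simp only [R2pc_eq_pairSum_div, pairSum_add_const_mul hfc hgc C N hN']
  ring
end

section
/- Let a : ℕ → ℝ be a lacunary sequence of positive reals (a(x) > 0 and a(x+1) ≥ C·a(x) for all x ≥ 1, with a fixed constant C > 1), and let ε > 0. Then there exists a constant c > 0 (depending on a and ε) such that for all integers N ≥ 2, #{(n,x,y) ∈ ℤ³ : 1 ≤ n ≤ N^{1+ε}, 1 ≤ x, y ≤ N, x ≠ y, n·|a(x) − a(y)| < N^ε} ≤ c·N^{2ε}. -/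
/-- A sequence with ratio `C` grows at least geometrically. -/
lemma lacunary_mul_pow_le {a : ℕ → ℝ} {C : ℝ} (hC : 1 < C)
    (hlac : ∀ x : ℕ, 1 ≤ x → C * a x ≤ a (x + 1)) (x : ℕ) (hx : 1 ≤ x) :
    a 1 * C ^ x ≤ C * a x := by
  induction x, hx using Nat.le_induction with
  | base => linarith
  | succ x hx ih =>
    calc a 1 * C ^ (x + 1) = C * (a 1 * C ^ x) := by ring
      _ ≤ C * (C * a x) := by gcongr
      _ ≤ C * a (x + 1) := by gcongr; exact hlac x hx

lemma lacunary_mono {a : ℕ → ℝ} {C : ℝ} (hC : 1 < C)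
    (hpos : ∀ x : ℕ, 1 ≤ x → 0 < a x)
    (hlac : ∀ x : ℕ, 1 ≤ x → C * a x ≤ a (x + 1)) {y x : ℕ} (hy : 1 ≤ y) (hyx : y ≤ x) :
    a y ≤ a x := by
  induction x, hyx using Nat.le_induction with
  | base => exact le_rfl
  | succ x hx ih => nlinarith [hlac x (hy.trans hx), hpos x (hy.trans hx)]

lemma lacunary_gap {a : ℕ → ℝ} {C : ℝ} (hC : 1 < C)
    (hpos : ∀ x : ℕ, 1 ≤ x → 0 < a x)
    (hlac : ∀ x : ℕ, 1 ≤ x → C * a x ≤ a (x + 1)) {y x : ℕ} (hy : 1 ≤ y) (hyx : y < x) :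
    (C - 1) * a 1 / C ^ 2 * C ^ x ≤ a x - a y := by
  obtain ⟨k, rfl⟩ : ∃ k, x = k + 1 := ⟨x - 1, by omega⟩
  have hyk : y ≤ k := by omega
  have h1 := lacunary_mono hC hpos hlac hy hyk
  have h2 := hlac k (hy.trans hyk)
  have h3 := lacunary_mul_pow_le hC hlac (k + 1) (by omega)
  have h4 : (C - 1) * a (k + 1) ≤ C * (a (k + 1) - a y) := by nlinarith
  rw [div_mul_eq_mul_div, div_le_iff₀ (by positivity)]
  calc (C - 1) * a 1 * C ^ (k + 1) = (C - 1) * (a 1 * C ^ (k + 1)) := by ring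
    _ ≤ (C - 1) * (C * a (k + 1)) := by gcongr
    _ = C * ((C - 1) * a (k + 1)) := by ring
    _ ≤ C * (C * (a (k + 1) - a y)) := by gcongr
    _ = (a (k + 1) - a y) * C ^ 2 := by ring

/-- The gaps of a lacunary sequence are bounded below by a product of geometric terms. -/
lemma lacunary_abs_sub {a : ℕ → ℝ} {s : ℝ} (hs : 1 < s)
    (hpos : ∀ x : ℕ, 1 ≤ x → 0 < a x)
    (hlac : ∀ x : ℕ, 1 ≤ x → s ^ 2 * a x ≤ a (x + 1)) {x y : ℕ} (hx : 1 ≤ x) (hy : 1 ≤ y)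
    (hxy : x ≠ y) :
    (s ^ 2 - 1) * a 1 / (s ^ 2) ^ 2 * (s ^ x * s ^ y) ≤ |a x - a y| := by
  wlog h : y < x generalizing x y
  · rw [abs_sub_comm, mul_comm (s ^ x)]
    exact this hy hx hxy.symm (by omega)
  have hC : 1 < s ^ 2 := one_lt_pow₀ hs two_ne_zero
  have h1 := hpos 1 le_rfl
  have hC' : 0 ≤ s ^ 2 - 1 := by linarith
  calc _ ≤ (s ^ 2 - 1) * a 1 / (s ^ 2) ^ 2 * (s ^ 2) ^ x := by
        rw [← pow_add, ← pow_mul s 2 x]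
        gcongr ?_ * ?_
        exact pow_le_pow_right₀ hs.le (by omega)
    _ ≤ a x - a y := lacunary_gap hC hpos hlac hy h
    _ ≤ _ := le_abs_self _

/-- If the gaps `|a x - a y|` dominate `δ * (s ^ x * s ^ y)`, then the number of triples is
`O(K)`, uniformly in `M` and `N`. -/
lemma countA_le_of_gap {a : ℕ → ℝ} {s δ : ℝ} (hs : 1 < s) (hδ : 0 < δ)
    (hgap : ∀ x y : ℕ, 1 ≤ x → 1 ≤ y → x ≠ y → δ * (s ^ x * s ^ y) ≤ |a x - a y|)
    (M : ℝ) {K : ℝ} (hK : 0 ≤ K) (N : ℕ) :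
    (countA a M K N : ℝ) ≤ K / δ * ((1 - s⁻¹)⁻¹) ^ 2 := by
  have hs0 : 0 < s := by linarith
  let B : ℕ × ℕ → ℝ := fun p => K / δ * (s⁻¹ ^ p.1 * s⁻¹ ^ p.2)
  have hB : ∀ p, 0 ≤ B p := fun p => by positivity
  let P := Finset.range (N + 1) ×ˢ Finset.range (N + 1)
  let T : Finset (ℤ × ℕ × ℕ) :=
    P.biUnion fun p => (Finset.Icc 1 ⌊B p⌋).image fun n => (n, p)
  have hsub : {t : ℤ × ℕ × ℕ | 1 ≤ t.1 ∧ (t.1 : ℝ) ≤ M ∧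
      1 ≤ t.2.1 ∧ t.2.1 ≤ N ∧ 1 ≤ t.2.2 ∧ t.2.2 ≤ N ∧ t.2.1 ≠ t.2.2 ∧
      (t.1 : ℝ) * |a t.2.1 - a t.2.2| < K} ⊆ (T : Set (ℤ × ℕ × ℕ)) := by
    rintro ⟨n, x, y⟩ ⟨hn, -, hx, hxN, hy, hyN, hxy, hlt⟩
    simp only at hn hx hxN hy hyN hxy hlt
    have hn' : (1 : ℝ) ≤ n := by exact_mod_cast hn
    have hle : (n : ℝ) * (δ * (s ^ x * s ^ y)) ≤ K :=
      (mul_le_mul_of_nonneg_left (hgap x y hx hy hxy) (by linarith)).trans hlt.le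
    have hnB : (n : ℝ) ≤ B (x, y) := by
      have : B (x, y) = K / (δ * (s ^ x * s ^ y)) := by
        simp only [B, inv_pow]
        field_simp
      rw [this, le_div_iff₀ (by positivity)]
      exact hle
    simp only [T, P, Finset.coe_biUnion, Set.mem_iUnion, Finset.mem_coe, Finset.mem_image,
      Finset.mem_product, Finset.mem_range, Finset.mem_Icc]
    exact ⟨(x, y), ⟨by simp only; omega, by simp only; omega⟩, n, ⟨hn, Int.le_floor.mpr hnB⟩, rfl⟩
  have hcard : (countA a M K N : ℝ) ≤ T.card := by
    have h := Set.ncard_le_ncard hsub T.finite_toSet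
    rw [Set.ncard_coe_finset] at h
    exact_mod_cast h
  have hgeom : ∑ x ∈ Finset.range (N + 1), s⁻¹ ^ x ≤ (1 - s⁻¹)⁻¹ := by
    have h1 : s⁻¹ < 1 := inv_lt_one_of_one_lt₀ hs
    rw [← tsum_geometric_of_lt_one (by positivity) h1]
    exact (summable_geometric_of_lt_one (by positivity) h1).sum_le_tsum _
      fun _ _ => by positivity
  calc (countA a M K N : ℝ) ≤ T.card := hcard
    _ ≤ ∑ p ∈ P, (((Finset.Icc 1 ⌊B p⌋).image fun n => (n, p)).card : ℝ) := by
        exact_mod_cast Finset.card_biUnion_le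
    _ ≤ ∑ p ∈ P, B p := by
        refine Finset.sum_le_sum fun p _ => ?_
        have h1 : ((Finset.Icc 1 ⌊B p⌋).image fun n => (n, p)).card ≤ ⌊B p⌋.toNat := by
          refine Finset.card_image_le.trans ?_
          simp
        have h2 : ((⌊B p⌋.toNat : ℤ) : ℝ) ≤ B p := by
          rw [Int.toNat_of_nonneg (Int.floor_nonneg.mpr (hB p))]
          exact Int.floor_le _
        refine (Nat.cast_le.mpr h1).trans ?_
        exact_mod_cast h2
    _ = K / δ * (∑ x ∈ Finset.range (N + 1), s⁻¹ ^ x) ^ 2 := by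
        rw [sq, Finset.sum_mul_sum, ← Finset.sum_product', Finset.mul_sum]
    _ ≤ K / δ * ((1 - s⁻¹)⁻¹) ^ 2 := by gcongr

/-- For a lacunary sequence of positive reals, the condition (A) holds
with a bound of `c·N^{2ε}`. -/
theorem countA_lacunary
    (a : ℕ → ℝ) (C : ℝ) (hC : 1 < C)
    (hpos : ∀ x : ℕ, 1 ≤ x → 0 < a x)
    (hlac : ∀ x : ℕ, 1 ≤ x → C * a x ≤ a (x + 1))
    (ε : ℝ) (hε : 0 < ε) :
    ∃ c : ℝ, 0 < c ∧ ∀ N : ℕ, 2 ≤ N →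
      (countA a ((N : ℝ) ^ ((1 : ℝ) + ε)) ((N : ℝ) ^ ε) N : ℝ) ≤ c * (N : ℝ) ^ (2 * ε) := by
  obtain ⟨s, hs, rfl⟩ : ∃ s : ℝ, 1 < s ∧ C = s ^ 2 :=
    ⟨√C, Real.lt_sqrt_of_sq_lt (by linarith), (Real.sq_sqrt (by linarith)).symm⟩
  have h1 := hpos 1 le_rfl
  have hC' : 0 < s ^ 2 - 1 := by linarith
  have hs0 : 0 < s := by linarith
  have hs1 : 0 < 1 - s⁻¹ := sub_pos.mpr (inv_lt_one_of_one_lt₀ hs)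
  set δ := (s ^ 2 - 1) * a 1 / (s ^ 2) ^ 2 with hδ_def
  have hδ : 0 < δ := by positivity
  refine ⟨1 / δ * ((1 - s⁻¹)⁻¹) ^ 2, by positivity, fun N hN => ?_⟩
  have hN1 : (1 : ℝ) ≤ N := by exact_mod_cast (by omega : 1 ≤ N)
  calc _ ≤ (N : ℝ) ^ ε / δ * ((1 - s⁻¹)⁻¹) ^ 2 :=
        countA_le_of_gap hs hδ
          (fun x y hx hy hxy => lacunary_abs_sub hs hpos hlac hx hy hxy) _ (by positivity) N
    _ = 1 / δ * ((1 - s⁻¹)⁻¹) ^ 2 * (N : ℝ) ^ ε := by ring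
    _ ≤ 1 / δ * ((1 - s⁻¹)⁻¹) ^ 2 * (N : ℝ) ^ (2 * ε) := by
        gcongr ?_ * ?_
        exact Real.rpow_le_rpow_of_exponent_le hN1 (by linarith)
end

section
/- Let a : ℕ → ℝ be a lacunary sequence of positive reals (a(x) > 0 and a(x+1) ≥ C·a(x) for all x ≥ 1, with a fixed constant C > 1). Let 0 < γ < Γ < 2 and let 0 < ε < γ. Then there exist a constant c > 0 and N₀ such that for all integers N ≥ N₀ and all real M with N^γ ≤ M ≤ N^Γ, the number of integer six-tuples (n₁,n₂,x₁,y₁,x₂,y₂) with 1 ≤ |nᵢ| ≤ M, 1 ≤ xᵢ, yᵢ ≤ N, xᵢ ≠ yᵢ (i = 1,2), satisfying |n₁(a(x₁) − a(y₁)) − n₂(a(x₂) − a(y₂))| < N^ε, is at most c·M·N²·(log M)². -/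
/-- The solutions of the Diophantine inequality normalised by `y₁ < x₁`, `y₂ < x₂` and `x₂ ≤ x₁`. -/
structure IsOrderedSol (a : ℕ → ℝ) (K : ℝ) (m N : ℕ) (n₁ n₂ : ℤ) (x₁ y₁ x₂ y₂ : ℕ) : Prop where
  n₁_ne : n₁ ≠ 0
  n₁_le : |n₁| ≤ m
  n₂_ne : n₂ ≠ 0
  n₂_le : |n₂| ≤ m
  y₁_pos : 1 ≤ y₁
  y₁_lt : y₁ < x₁
  x₁_le : x₁ ≤ N
  y₂_pos : 1 ≤ y₂
  y₂_lt : y₂ < x₂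
  x₂_le : x₂ ≤ x₁
  abs_lt : |(n₁ : ℝ) * (a x₁ - a y₁) - (n₂ : ℝ) * (a x₂ - a y₂)| < K

/-- The set of normalised solutions. -/
def orderedSols (a : ℕ → ℝ) (K : ℝ) (m N : ℕ) : Set (ℤ × ℤ × ℕ × ℕ × ℕ × ℕ) :=
  {t | IsOrderedSol a K m N t.1 t.2.1 t.2.2.1 t.2.2.2.1 t.2.2.2.2.1 t.2.2.2.2.2}

theorem orderedSols_finite (a : ℕ → ℝ) (K : ℝ) (m N : ℕ) : (orderedSols a K m N).Finite := by
  refine (Finset.finite_toSet (Finset.Icc (-(m : ℤ)) m ×ˢ Finset.Icc (-(m : ℤ)) m ×ˢ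
    Finset.range (N + 1) ×ˢ Finset.range (N + 1) ×ˢ Finset.range (N + 1) ×ˢ
    Finset.range (N + 1))).subset ?_
  rintro ⟨n₁, n₂, x₁, y₁, x₂, y₂⟩ h
  have h₁ := abs_le.1 h.n₁_le
  have h₂ := abs_le.1 h.n₂_le
  have h₃ := h.y₁_lt
  have h₄ := h.x₁_le
  have h₅ := h.y₂_lt
  have h₆ := h.x₂_le
  simp only at h₁ h₂ h₃ h₄ h₅ h₆
  simp only [Finset.coe_product, Set.mem_prod, Finset.mem_coe, Finset.mem_Icc, Finset.mem_range]
  omega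

/-- Undo the normalisation: optionally exchange the two halves of a tuple, and optionally exchange
`xᵢ` and `yᵢ` while changing the sign of `nᵢ`. -/
def unorder (p : (ℤ × ℤ × ℕ × ℕ × ℕ × ℕ) × Bool × Bool × Bool) : ℤ × ℤ × ℕ × ℕ × ℕ × ℕ :=
  match p with
  | ((n₁, n₂, x₁, y₁, x₂, y₂), s, f, g) =>
    match (if s then (n₂, n₁, x₂, y₂, x₁, y₁) else (n₁, n₂, x₁, y₁, x₂, y₂) :
      ℤ × ℤ × ℕ × ℕ × ℕ × ℕ) with
    | (n₁, n₂, x₁, y₁, x₂, y₂) =>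
      (if f then -n₁ else n₁, if g then -n₂ else n₂, if f then y₁ else x₁, if f then x₁ else y₁,
        if g then y₂ else x₂, if g then x₂ else y₂)

theorem countB_le_orderedSols (a : ℕ → ℝ) (M K : ℝ) (N : ℕ) :
    countB a M K N ≤ 8 * (orderedSols a K ⌊M⌋₊ N).ncard := by
  have hfin := orderedSols_finite a K ⌊M⌋₊ N
  have hprod : (orderedSols a K ⌊M⌋₊ N ×ˢ (Set.univ : Set (Bool × Bool × Bool))).ncard =
      8 * (orderedSols a K ⌊M⌋₊ N).ncard := by
    rw [Set.ncard_prod, Set.ncard_univ, mul_comm]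
    simp
  have hpfin := hfin.prod (Set.finite_univ (α := Bool × Bool × Bool))
  rw [← hprod]
  refine le_trans (Set.ncard_le_ncard ?_ (hpfin.image unorder)) (Set.ncard_image_le hpfin)
  rintro ⟨n₁, n₂, x₁, y₁, x₂, y₂⟩ ⟨hn₁, hn₁', hn₂, hn₂', hx₁, hx₁', hy₁, hy₁', h₁, hx₂, hx₂', hy₂,
    hy₂', h₂, h⟩
  simp only at hn₁ hn₁' hn₂ hn₂' hx₁ hx₁' hy₁ hy₁' h₁ hx₂ hx₂' hy₂ hy₂' h₂ h
  have floor_le : ∀ n : ℤ, ((|n| : ℤ) : ℝ) ≤ M → |n| ≤ (⌊M⌋₊ : ℤ) := by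
    intro n hn
    rw [Int.abs_eq_natAbs, Int.cast_natCast] at hn
    rw [Int.abs_eq_natAbs]
    exact_mod_cast Nat.le_floor hn
  have hm₁ := floor_le n₁ (by exact_mod_cast hn₁')
  have hm₂ := floor_le n₂ (by exact_mod_cast hn₂')
  have hz₁ : n₁ ≠ 0 := by rintro rfl; simp at hn₁
  have hz₂ : n₂ ≠ 0 := by rintro rfl; simp at hn₂
  rw [_root_.abs_lt] at h
  rcases lt_or_gt_of_ne h₁ with l₁ | l₁ <;> rcases lt_or_gt_of_ne h₂ with l₂ | l₂
  · rcases le_total y₂ y₁ with l | l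
    · refine ⟨((-n₁, -n₂, y₁, x₁, y₂, x₂), false, true, true), ⟨⟨?_, ?_, ?_, ?_, ?_, ?_, ?_, ?_, ?_,
        ?_, ?_⟩, trivial⟩, by simp [unorder]⟩ <;>
        simp only [abs_neg, ne_eq, neg_eq_zero, Int.cast_neg, _root_.abs_lt] <;> try assumption
      constructor <;> linarith
    · refine ⟨((-n₂, -n₁, y₂, x₂, y₁, x₁), true, true, true), ⟨⟨?_, ?_, ?_, ?_, ?_, ?_, ?_, ?_, ?_,
        ?_, ?_⟩, trivial⟩, by simp [unorder]⟩ <;>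
        simp only [abs_neg, ne_eq, neg_eq_zero, Int.cast_neg, _root_.abs_lt] <;> try assumption
      constructor <;> linarith
  · rcases le_total x₂ y₁ with l | l
    · refine ⟨((-n₁, n₂, y₁, x₁, x₂, y₂), false, true, false), ⟨⟨?_, ?_, ?_, ?_, ?_, ?_, ?_, ?_, ?_,
        ?_, ?_⟩, trivial⟩, by simp [unorder]⟩ <;>
        simp only [abs_neg, ne_eq, neg_eq_zero, Int.cast_neg, _root_.abs_lt] <;> try assumption
      constructor <;> linarith
    · refine ⟨((n₂, -n₁, x₂, y₂, y₁, x₁), true, true, false), ⟨⟨?_, ?_, ?_, ?_, ?_, ?_, ?_, ?_, ?_,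
        ?_, ?_⟩, trivial⟩, by simp [unorder]⟩ <;>
        simp only [abs_neg, ne_eq, neg_eq_zero, Int.cast_neg, _root_.abs_lt] <;> try assumption
      constructor <;> linarith
  · rcases le_total y₂ x₁ with l | l
    · refine ⟨((n₁, -n₂, x₁, y₁, y₂, x₂), false, false, true), ⟨⟨?_, ?_, ?_, ?_, ?_, ?_, ?_, ?_, ?_,
        ?_, ?_⟩, trivial⟩, by simp [unorder]⟩ <;>
        simp only [abs_neg, ne_eq, neg_eq_zero, Int.cast_neg, _root_.abs_lt] <;> try assumption
      constructor <;> linarith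
    · refine ⟨((-n₂, n₁, y₂, x₂, x₁, y₁), true, false, true), ⟨⟨?_, ?_, ?_, ?_, ?_, ?_, ?_, ?_, ?_,
        ?_, ?_⟩, trivial⟩, by simp [unorder]⟩ <;>
        simp only [abs_neg, ne_eq, neg_eq_zero, Int.cast_neg, _root_.abs_lt] <;> try assumption
      constructor <;> linarith
  · rcases le_total x₂ x₁ with l | l
    · refine ⟨((n₁, n₂, x₁, y₁, x₂, y₂), false, false, false), ⟨⟨?_, ?_, ?_, ?_, ?_, ?_, ?_, ?_, ?_,
        ?_, ?_⟩, trivial⟩, by simp [unorder]⟩ <;>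
        simp only [_root_.abs_lt] <;> try assumption
    · refine ⟨((n₂, n₁, x₂, y₂, x₁, y₁), true, false, false), ⟨⟨?_, ?_, ?_, ?_, ?_, ?_, ?_, ?_, ?_,
        ?_, ?_⟩, trivial⟩, by simp [unorder]⟩ <;>
        simp only [_root_.abs_lt] <;> try assumption
      constructor <;> linarith

section Lacunary

variable {a : ℕ → ℝ} {C : ℝ}

theorem pow_mul_le_of_lacunary (hC : 1 < C) (hlac : ∀ x : ℕ, 1 ≤ x → C * a x ≤ a (x + 1))
    {x : ℕ} (hx : 1 ≤ x) (k : ℕ) : C ^ k * a x ≤ a (x + k) := by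
  induction k with
  | zero => simp
  | succ k ih =>
    calc C ^ (k + 1) * a x = C * (C ^ k * a x) := by ring
      _ ≤ C * a (x + k) := by gcongr
      _ ≤ a (x + (k + 1)) := hlac _ (by omega)

theorem pow_mul_le_of_lacunary_of_le (hC : 1 < C) (hpos : ∀ x : ℕ, 1 ≤ x → 0 < a x)
    (hlac : ∀ x : ℕ, 1 ≤ x → C * a x ≤ a (x + 1)) {x y k : ℕ} (hy : 1 ≤ y) (h : y + k ≤ x) :
    C ^ k * a y ≤ a x := by
  obtain ⟨j, rfl⟩ := Nat.exists_eq_add_of_le h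
  have h₁ := pow_mul_le_of_lacunary hC hlac hy k
  have h₂ := pow_mul_le_of_lacunary hC hlac (show 1 ≤ y + k by omega) j
  have h₃ : 1 ≤ C ^ j := one_le_pow₀ hC.le
  nlinarith [hpos (y + k) (by omega)]

theorem le_sub_of_lacunary (hC : 1 < C) (hpos : ∀ x : ℕ, 1 ≤ x → 0 < a x)
    (hlac : ∀ x : ℕ, 1 ≤ x → C * a x ≤ a (x + 1)) {x y : ℕ} (hy : 1 ≤ y) (h : y < x) :
    (1 - C⁻¹) * a x ≤ a x - a y := by
  have h₁ := pow_mul_le_of_lacunary_of_le hC hpos hlac hy (show y + 1 ≤ x from h)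
  have h₂ : a y ≤ C⁻¹ * a x := by
    rw [inv_mul_eq_div, le_div_iff₀ (by linarith)]
    linarith
  linarith

theorem eq_of_abs_mul_sub_lt {n n' : ℤ} {A D K : ℝ} (hA : 2 * K ≤ A) (h : |n * A - D| < K)
    (h' : |n' * A - D| < K) : n = n' := by
  by_contra hne
  have hK : 0 < K := (abs_nonneg _).trans_lt h
  have h₁ : (1 : ℝ) ≤ |(n : ℝ) - n'| := by
    exact_mod_cast Int.one_le_abs (sub_ne_zero.2 hne)
  have h₂ : |((n : ℝ) - n') * A| < 2 * K := by
    rw [abs_lt] at *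
    constructor <;> linarith
  rw [abs_mul, abs_of_pos (show 0 < A by linarith)] at h₂
  nlinarith

/-- If `(1 - C⁻¹) a(y)` exceeds `2K` beyond `L`, then at most one `y > L` has
`|n a(y) - D| < K`. -/
theorem eq_of_abs_mul_lacunary_sub_lt (hC : 1 < C) (hpos : ∀ x : ℕ, 1 ≤ x → 0 < a x)
    (hlac : ∀ x : ℕ, 1 ≤ x → C * a x ≤ a (x + 1)) {K D : ℝ} {L : ℕ}
    (hL : ∀ x, L < x → 2 * K ≤ (1 - C⁻¹) * a x) {n : ℤ} (hn : n ≠ 0) {y y' : ℕ} (hy : L < y)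
    (hy' : L < y') (h : |n * a y - D| < K) (h' : |n * a y' - D| < K) : y = y' := by
  have key : ∀ y y' : ℕ, L < y → y < y' → |n * a y - D| < K → |n * a y' - D| < K → False := by
    intro y y' hy hlt h h'
    have h₁ : (1 : ℝ) ≤ |(n : ℝ)| := by exact_mod_cast Int.one_le_abs hn
    have h₂ : |(n : ℝ) * (a y' - a y)| < 2 * K := by
      rw [abs_lt] at *
      constructor <;> linarith
    have h₃ := le_sub_of_lacunary hC hpos hlac (by omega : 1 ≤ y) hlt
    have h₄ := hL y' (by omega)
    have hK : 0 < K := (abs_nonneg _).trans_lt h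
    rw [abs_mul, abs_of_pos (show 0 < a y' - a y by linarith)] at h₂
    nlinarith
  rcases lt_trichotomy y y' with hlt | heq | hlt
  · exact (key y y' hy hlt h h').elim
  · exact heq
  · exact (key y' y hy' hlt h' h).elim

variable {M K : ℝ} {m N L : ℕ}

theorem IsOrderedSol.x₁_le_x₂_add (hC : 1 < C) (hpos : ∀ x : ℕ, 1 ≤ x → 0 < a x)
    (hlac : ∀ x : ℕ, 1 ≤ x → C * a x ≤ a (x + 1)) (hL : ∀ x, L < x → 4 * K ≤ (1 - C⁻¹) * a x)
    (hCL : 8 * (m : ℝ) ≤ (1 - C⁻¹) * C ^ L) {n₁ n₂ : ℤ} {x₁ y₁ x₂ y₂ : ℕ}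
    (h : IsOrderedSol a K m N n₁ n₂ x₁ y₁ x₂ y₂) (hx : L < x₁) : x₁ ≤ x₂ + L := by
  by_contra! hlt
  have hx₂ : 1 ≤ x₂ := h.y₂_pos.trans h.y₂_lt.le
  have h₁ : (1 : ℝ) ≤ |(n₁ : ℝ)| := by exact_mod_cast Int.one_le_abs h.n₁_ne
  have h₂ : |(n₂ : ℝ)| ≤ m := by exact_mod_cast h.n₂_le
  have hA₁ := le_sub_of_lacunary hC hpos hlac h.y₁_pos h.y₁_lt
  have hA₂ := le_sub_of_lacunary hC hpos hlac h.y₂_pos h.y₂_lt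
  have hκ : 0 < 1 - C⁻¹ := sub_pos.2 (inv_lt_one_of_one_lt₀ hC)
  have p₁ := hpos x₁ (by omega)
  have p₂ := hpos x₂ hx₂
  have q₂ := hpos y₂ h.y₂_pos
  have q₃ := mul_pos hκ p₁
  have q₄ := mul_pos hκ p₂
  have h₃ := pow_mul_le_of_lacunary_of_le hC hpos hlac hx₂ hlt.le
  have h₄ := hL x₁ hx
  have h₅ : |(n₁ : ℝ)| * (a x₁ - a y₁) < K + |(n₂ : ℝ)| * (a x₂ - a y₂) := by
    have := abs_sub_abs_le_abs_sub ((n₁ : ℝ) * (a x₁ - a y₁)) ((n₂ : ℝ) * (a x₂ - a y₂))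
    rw [abs_mul, abs_mul, abs_of_pos (show 0 < a x₁ - a y₁ by linarith),
      abs_of_pos (show 0 < a x₂ - a y₂ by linarith)] at this
    linarith [h.abs_lt]
  have h₆ : |(n₂ : ℝ)| * (a x₂ - a y₂) ≤ m * a x₂ := by gcongr <;> linarith
  have h₇ : a x₁ - a y₁ ≤ |(n₁ : ℝ)| * (a x₁ - a y₁) := le_mul_of_one_le_left (by linarith) h₁
  have h₈ : 8 * ((m : ℝ) * a x₂) ≤ (1 - C⁻¹) * a x₁ := by
    calc 8 * ((m : ℝ) * a x₂) = 8 * (m : ℝ) * a x₂ := by ring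
      _ ≤ (1 - C⁻¹) * C ^ L * a x₂ := by gcongr
      _ = (1 - C⁻¹) * (C ^ L * a x₂) := by ring
      _ ≤ _ := by gcongr
  linarith

theorem IsOrderedSol.n₁_unique (hC : 1 < C) (hpos : ∀ x : ℕ, 1 ≤ x → 0 < a x)
    (hlac : ∀ x : ℕ, 1 ≤ x → C * a x ≤ a (x + 1)) (hL : ∀ x, L < x → 4 * K ≤ (1 - C⁻¹) * a x)
    {n₁ n₁' n₂ : ℤ} {x₁ y₁ x₂ y₂ : ℕ} (h : IsOrderedSol a K m N n₁ n₂ x₁ y₁ x₂ y₂)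
    (h' : IsOrderedSol a K m N n₁' n₂ x₁ y₁ x₂ y₂) (hx : L < x₁) : n₁ = n₁' := by
  refine eq_of_abs_mul_sub_lt ?_ h.abs_lt h'.abs_lt
  have := le_sub_of_lacunary hC hpos hlac h.y₁_pos h.y₁_lt
  linarith [hL x₁ hx, (abs_nonneg _).trans_lt h.abs_lt]

/-- When `y₁` and `y₂` are small compared with `x₁` and `x₂`, the integer `n₁` is determined by
`n₂`, `x₁` and `x₂` alone. -/
theorem IsOrderedSol.n₁_unique_of_add_lt (hC : 1 < C) (hpos : ∀ x : ℕ, 1 ≤ x → 0 < a x)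
    (hlac : ∀ x : ℕ, 1 ≤ x → C * a x ≤ a (x + 1)) (hL : ∀ x, L < x → 4 * K ≤ (1 - C⁻¹) * a x)
    (hCL : 8 * (m : ℝ) ≤ (1 - C⁻¹) * C ^ L) {n₁ n₁' n₂ : ℤ} {x₁ y₁ y₁' x₂ y₂ y₂' : ℕ}
    (h : IsOrderedSol a K m N n₁ n₂ x₁ y₁ x₂ y₂) (h' : IsOrderedSol a K m N n₁' n₂ x₁ y₁' x₂ y₂')
    (hy₁ : y₁ + L < x₁) (hy₂ : y₂ + L < x₂) (hy₁' : y₁' + L < x₁) (hy₂' : y₂' + L < x₂) :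
    n₁ = n₁' := by
  have hx₁ : 0 < a x₁ := hpos _ (by omega)
  have hK := hL x₁ (by omega)
  have hC₀ : 0 < C⁻¹ := by positivity
  have hCL' : 8 * (m : ℝ) ≤ C ^ L := by nlinarith [pow_pos (zero_lt_one.trans hC) L]
  have small : ∀ (n : ℤ) (y : ℕ), |n| ≤ m → 1 ≤ y → y + L < x₁ → |n * a y| ≤ a x₁ / 8 := by
    intro n y hn hy hlt
    have h₁ : |(n : ℝ)| ≤ m := by exact_mod_cast hn
    have h₂ := pow_mul_le_of_lacunary_of_le hC hpos hlac hy hlt.le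
    have h₃ := hpos y hy
    rw [abs_mul, abs_of_pos h₃]
    nlinarith
  have approx : ∀ (n : ℤ) (y z : ℕ), IsOrderedSol a K m N n n₂ x₁ y x₂ z → y + L < x₁ →
      z + L < x₂ → |n * a x₁ - n₂ * a x₂| < a x₁ / 2 := by
    intro n y z hs hy hz
    have h₁ := abs_le.1 (small n y hs.n₁_le hs.y₁_pos hy)
    have h₂ := abs_le.1 (small n₂ z hs.n₂_le hs.y₂_pos (hz.trans_le hs.x₂_le))
    have h₃ := _root_.abs_lt.1 hs.abs_lt
    have h₄ : (1 - C⁻¹) * a x₁ ≤ a x₁ := by nlinarith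
    rw [_root_.abs_lt]
    constructor <;> linarith
  exact eq_of_abs_mul_sub_lt (by linarith) (approx _ _ _ h hy₁ hy₂) (approx _ _ _ h' hy₁' hy₂')

/-- The codomain of the injections used to count the solutions with `x₁` large. -/
noncomputable def countingBox (m N L : ℕ) : Finset (ℤ × ℕ × ℕ × ℕ × ℕ) :=
  Finset.Icc (-(m : ℤ)) m ×ˢ Finset.Icc 1 N ×ˢ Finset.Icc 1 N ×ˢ Finset.range (L + 1) ×ˢ
    Finset.range (L + 1)

theorem ncard_le_countingBox {s : Set (ℤ × ℤ × ℕ × ℕ × ℕ × ℕ)}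
    (f : ℤ × ℤ × ℕ × ℕ × ℕ × ℕ → ℤ × ℕ × ℕ × ℕ × ℕ)
    (hf : ∀ t ∈ s, f t ∈ countingBox m N L) (hinj : Set.InjOn f s) :
    s.ncard ≤ (2 * m + 1) * N ^ 2 * (L + 1) ^ 2 := by
  have h := Set.ncard_le_ncard_of_injOn f hf hinj (Finset.finite_toSet _)
  rw [Set.ncard_coe_finset] at h
  refine h.trans (le_of_eq ?_)
  simp only [countingBox, Finset.card_product, Int.card_Icc, Nat.card_Icc, Finset.card_range]
  rw [show ((m : ℤ) + 1 - -(m : ℤ)).toNat = 2 * m + 1 by omega, Nat.add_sub_cancel]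
  ring

theorem ncard_orderedSols_large (hC : 1 < C) (hpos : ∀ x : ℕ, 1 ≤ x → 0 < a x)
    (hlac : ∀ x : ℕ, 1 ≤ x → C * a x ≤ a (x + 1)) (hL : ∀ x, L < x → 4 * K ≤ (1 - C⁻¹) * a x)
    (hCL : 8 * (m : ℝ) ≤ (1 - C⁻¹) * C ^ L) :
    (orderedSols a K m N ∩ {t | L < t.2.2.1}).ncard ≤
      4 * ((2 * m + 1) * N ^ 2 * (L + 1) ^ 2) := by
  set S := orderedSols a K m N ∩ {t | L < t.2.2.1}
  have hfin : S.Finite := (orderedSols_finite a K m N).inter_of_left _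
  have hcover : S ⊆ ((S ∩ {t | t.2.2.1 ≤ t.2.2.2.1 + L}) ∪
      (S ∩ {t | t.2.2.2.2.1 ≤ t.2.2.2.2.2 + L})) ∪ ((S ∩ {t | t.2.2.2.1 ≤ L}) ∪
      (S ∩ {t | t.2.2.2.1 + L < t.2.2.1 ∧ t.2.2.2.2.2 + L < t.2.2.2.2.1 ∧ L < t.2.2.2.1})) := by
    intro t ht
    simp only [Set.mem_union, Set.mem_inter_iff, ht, true_and, Set.mem_ofPred_eq]
    omega
  have hdata : ∀ {n₁ n₂ : ℤ} {x₁ y₁ x₂ y₂ : ℕ}, (n₁, n₂, x₁, y₁, x₂, y₂) ∈ S →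
      (-(m : ℤ) ≤ n₂ ∧ n₂ ≤ m) ∧ 1 ≤ y₁ ∧ y₁ < x₁ ∧ x₁ ≤ N ∧ 1 ≤ y₂ ∧ y₂ < x₂ ∧ x₂ ≤ x₁ ∧
        x₁ ≤ x₂ + L := fun ⟨h, hx⟩ ↦
    ⟨abs_le.1 h.n₂_le, h.y₁_pos, h.y₁_lt, h.x₁_le, h.y₂_pos, h.y₂_lt, h.x₂_le,
      h.x₁_le_x₂_add hC hpos hlac hL hCL hx⟩
  have huniq : ∀ {n₁ n₁' n₂ : ℤ} {x₁ y₁ x₂ y₂ : ℕ}, (n₁, n₂, x₁, y₁, x₂, y₂) ∈ S →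
      (n₁', n₂, x₁, y₁, x₂, y₂) ∈ S → n₁ = n₁' := fun ⟨h, hx⟩ ⟨h', _⟩ ↦
    h.n₁_unique hC hpos hlac hL h' hx
  have close₁ : (S ∩ {t | t.2.2.1 ≤ t.2.2.2.1 + L}).ncard ≤
      (2 * m + 1) * N ^ 2 * (L + 1) ^ 2 := by
    refine ncard_le_countingBox (fun t ↦ (t.2.1, t.2.2.1, t.2.2.2.2.2, t.2.2.1 - t.2.2.2.2.1,
      t.2.2.1 - t.2.2.2.1)) ?_ ?_
    · rintro ⟨n₁, n₂, x₁, y₁, x₂, y₂⟩ ⟨h, hc⟩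
      have := hdata h
      simp only [Set.mem_ofPred_eq] at hc
      simp only [countingBox, Finset.mem_product, Finset.mem_Icc, Finset.mem_range]
      omega
    · rintro ⟨n₁, n₂, x₁, y₁, x₂, y₂⟩ ⟨h, hc⟩ ⟨n₁', n₂', x₁', y₁', x₂', y₂'⟩ ⟨h', hc'⟩ heq
      have d := hdata h
      have d' := hdata h'
      simp only [Prod.mk.injEq] at heq
      obtain ⟨rfl, rfl, rfl, e₁, e₂⟩ := heq
      obtain rfl : x₂ = x₂' := by omega
      obtain rfl : y₁ = y₁' := by omega
      rw [huniq h h']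
  have close₂ : (S ∩ {t | t.2.2.2.2.1 ≤ t.2.2.2.2.2 + L}).ncard ≤
      (2 * m + 1) * N ^ 2 * (L + 1) ^ 2 := by
    refine ncard_le_countingBox (fun t ↦ (t.2.1, t.2.2.1, t.2.2.2.1, t.2.2.1 - t.2.2.2.2.1,
      t.2.2.2.2.1 - t.2.2.2.2.2)) ?_ ?_
    · rintro ⟨n₁, n₂, x₁, y₁, x₂, y₂⟩ ⟨h, hc⟩
      have := hdata h
      simp only [Set.mem_ofPred_eq] at hc
      simp only [countingBox, Finset.mem_product, Finset.mem_Icc, Finset.mem_range]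
      omega
    · rintro ⟨n₁, n₂, x₁, y₁, x₂, y₂⟩ ⟨h, hc⟩ ⟨n₁', n₂', x₁', y₁', x₂', y₂'⟩ ⟨h', hc'⟩ heq
      have d := hdata h
      have d' := hdata h'
      simp only [Prod.mk.injEq] at heq
      obtain ⟨rfl, rfl, rfl, e₁, e₂⟩ := heq
      obtain rfl : x₂ = x₂' := by omega
      obtain rfl : y₂ = y₂' := by omega
      rw [huniq h h']
  have small : (S ∩ {t | t.2.2.2.1 ≤ L}).ncard ≤ (2 * m + 1) * N ^ 2 * (L + 1) ^ 2 := by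
    refine ncard_le_countingBox (fun t ↦ (t.2.1, t.2.2.1, t.2.2.2.2.2, t.2.2.1 - t.2.2.2.2.1,
      t.2.2.2.1)) ?_ ?_
    · rintro ⟨n₁, n₂, x₁, y₁, x₂, y₂⟩ ⟨h, hc⟩
      have := hdata h
      simp only [Set.mem_ofPred_eq] at hc
      simp only [countingBox, Finset.mem_product, Finset.mem_Icc, Finset.mem_range]
      omega
    · rintro ⟨n₁, n₂, x₁, y₁, x₂, y₂⟩ ⟨h, hc⟩ ⟨n₁', n₂', x₁', y₁', x₂', y₂'⟩ ⟨h', hc'⟩ heq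
      have d := hdata h
      have d' := hdata h'
      simp only [Prod.mk.injEq] at heq
      obtain ⟨rfl, rfl, rfl, e₁, rfl⟩ := heq
      obtain rfl : x₂ = x₂' := by omega
      rw [huniq h h']
  have far : (S ∩ {t | t.2.2.2.1 + L < t.2.2.1 ∧ t.2.2.2.2.2 + L < t.2.2.2.2.1 ∧
      L < t.2.2.2.1}).ncard ≤ (2 * m + 1) * N ^ 2 * (L + 1) ^ 2 := by
    refine ncard_le_countingBox (fun t ↦ (t.2.1, t.2.2.1, t.2.2.2.2.2, t.2.2.1 - t.2.2.2.2.1,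
      0)) ?_ ?_
    · rintro ⟨n₁, n₂, x₁, y₁, x₂, y₂⟩ ⟨h, hc⟩
      have := hdata h
      simp only [countingBox, Finset.mem_product, Finset.mem_Icc, Finset.mem_range]
      omega
    · rintro ⟨n₁, n₂, x₁, y₁, x₂, y₂⟩ ⟨h, hc⟩ ⟨n₁', n₂', x₁', y₁', x₂', y₂'⟩ ⟨h', hc'⟩ heq
      have d := hdata h
      have d' := hdata h'
      simp only [Prod.mk.injEq] at heq
      obtain ⟨rfl, rfl, rfl, e₁, -⟩ := heq
      obtain rfl : x₂ = x₂' := by omega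
      obtain rfl : n₁ = n₁' :=
        h.1.n₁_unique_of_add_lt hC hpos hlac hL hCL h'.1 hc.1 hc.2.1 hc'.1 hc'.2.1
      have hK : 0 < K := (abs_nonneg _).trans_lt h.1.abs_lt
      have i := _root_.abs_lt.1 h.1.abs_lt
      have i' := _root_.abs_lt.1 h'.1.abs_lt
      simp only at i i'
      obtain rfl : y₁ = y₁' := by
        refine eq_of_abs_mul_lacunary_sub_lt hC hpos hlac (K := K)
          (D := n₁ * a x₁ - n₂ * (a x₂ - a y₂)) (fun x hx ↦ by linarith [hL x hx])
          h.1.n₁_ne hc.2.2 hc'.2.2 ?_ ?_ <;>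
        · rw [_root_.abs_lt]
          constructor <;> linarith
      rfl
  have hu := Set.ncard_le_ncard hcover ((((hfin.inter_of_left _).union (hfin.inter_of_left _))).union
    ((hfin.inter_of_left _).union (hfin.inter_of_left _)))
  have hu₁ := Set.ncard_union_le ((S ∩ {t | t.2.2.1 ≤ t.2.2.2.1 + L}) ∪
      (S ∩ {t | t.2.2.2.2.1 ≤ t.2.2.2.2.2 + L})) ((S ∩ {t | t.2.2.2.1 ≤ L}) ∪
      (S ∩ {t | t.2.2.2.1 + L < t.2.2.1 ∧ t.2.2.2.2.2 + L < t.2.2.2.2.1 ∧ L < t.2.2.2.1}))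
  have hu₂ := Set.ncard_union_le (S ∩ {t | t.2.2.1 ≤ t.2.2.2.1 + L})
      (S ∩ {t | t.2.2.2.2.1 ≤ t.2.2.2.2.2 + L})
  have hu₃ := Set.ncard_union_le (S ∩ {t | t.2.2.2.1 ≤ L})
      (S ∩ {t | t.2.2.2.1 + L < t.2.2.1 ∧ t.2.2.2.2.2 + L < t.2.2.2.2.1 ∧ L < t.2.2.2.1})
  linarith

theorem ncard_orderedSols_small (hC : 1 < C) (hpos : ∀ x : ℕ, 1 ≤ x → 0 < a x)
    (hlac : ∀ x : ℕ, 1 ≤ x → C * a x ≤ a (x + 1)) {J : ℕ}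
    (hJ : K / ((1 - C⁻¹) * a 1) + 1 ≤ J) :
    (orderedSols a K m N ∩ {t | t.2.2.1 ≤ L}).ncard ≤ (2 * m + 1) * (2 * J + 1) * L ^ 4 := by
  have h := Set.ncard_le_ncard_of_injOn (s := orderedSols a K m N ∩ {t | t.2.2.1 ≤ L})
    (t := ↑(Finset.Icc (-(m : ℤ)) m ×ˢ Finset.Icc (-(J : ℤ)) J ×ˢ Finset.Icc 1 L ×ˢ
      Finset.Icc 1 L ×ˢ Finset.Icc 1 L ×ˢ Finset.Icc 1 L))
    (fun t ↦ (t.2.1, t.1 - ⌊t.2.1 * (a t.2.2.2.2.1 - a t.2.2.2.2.2) /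
      (a t.2.2.1 - a t.2.2.2.1)⌋, t.2.2)) ?_ ?_ (Finset.finite_toSet _)
  · rw [Set.ncard_coe_finset] at h
    refine h.trans (le_of_eq ?_)
    simp only [Finset.card_product, Int.card_Icc, Nat.card_Icc]
    rw [show ((m : ℤ) + 1 - -(m : ℤ)).toNat = 2 * m + 1 by omega,
      show ((J : ℤ) + 1 - -(J : ℤ)).toNat = 2 * J + 1 by omega, Nat.add_sub_cancel]
    ring
  · rintro ⟨n₁, n₂, x₁, y₁, x₂, y₂⟩ ⟨h, hx⟩
    have hlt := h.abs_lt
    have h₁ := h.y₁_lt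
    have h₂ := h.y₂_lt
    have h₃ := h.y₁_pos
    have h₄ := h.y₂_pos
    have h₅ := h.x₂_le
    have h₆ := abs_le.1 h.n₂_le
    simp only [Set.mem_ofPred_eq] at hlt h₁ h₂ h₃ h₄ h₅ h₆ hx
    have hA := le_sub_of_lacunary hC hpos hlac h₃ h₁
    have hκ : 0 < 1 - C⁻¹ := sub_pos.2 (inv_lt_one_of_one_lt₀ hC)
    have ha₁ := hpos 1 le_rfl
    have ha : a 1 ≤ a x₁ := by
      simpa using pow_mul_le_of_lacunary_of_le hC hpos hlac le_rfl (k := 0)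
        (show 1 + 0 ≤ x₁ by omega)
    have hA' : (1 - C⁻¹) * a 1 ≤ a x₁ - a y₁ := hA.trans' (by gcongr)
    have hα : 0 < (1 - C⁻¹) * a 1 := by positivity
    have hK : 0 < K := (abs_nonneg _).trans_lt hlt
    set A := a x₁ - a y₁
    set D := (n₂ : ℝ) * (a x₂ - a y₂)
    have hA₀ : 0 < A := hα.trans_le hA'
    have hq : |(n₁ : ℝ) - D / A| < K / ((1 - C⁻¹) * a 1) := by
      have : (n₁ : ℝ) - D / A = (n₁ * A - D) / A := by field_simp
      rw [this, abs_div, abs_of_pos hA₀]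
      exact (div_lt_div_of_pos_right hlt hA₀).trans_le (by gcongr)
    rw [_root_.abs_lt] at hq
    have f₁ := Int.floor_le (D / A)
    have f₂ := Int.lt_floor_add_one (D / A)
    have g₁ : -(J : ℤ) ≤ n₁ - ⌊D / A⌋ := by
      have : (-(J : ℝ)) ≤ n₁ - ⌊D / A⌋ := by linarith
      exact_mod_cast this
    have g₂ : n₁ - ⌊D / A⌋ ≤ J := by
      have : (n₁ : ℝ) - ⌊D / A⌋ ≤ J := by linarith
      exact_mod_cast this
    simp only [Finset.coe_product, Set.mem_prod, Finset.mem_coe, Finset.mem_Icc]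
    exact ⟨h₆, ⟨g₁, g₂⟩, by omega, by omega, by omega, by omega⟩
  · rintro ⟨n₁, n₂, r⟩ - ⟨n₁', n₂', r'⟩ - heq
    simp only [Prod.mk.injEq] at heq
    obtain ⟨rfl, e, rfl⟩ := heq
    rw [sub_left_inj.1 e]

theorem countB_le (hC : 1 < C) (hpos : ∀ x : ℕ, 1 ≤ x → 0 < a x)
    (hlac : ∀ x : ℕ, 1 ≤ x → C * a x ≤ a (x + 1)) (hM : 0 ≤ M) (hKM : K ≤ M)
    (hL₁ : 4 * M ≤ (1 - C⁻¹) * a 1 * C ^ L) (hL₂ : 8 * M ≤ (1 - C⁻¹) * C ^ L) {J : ℕ}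
    (hJ : K / ((1 - C⁻¹) * a 1) + 1 ≤ J) :
    (countB a M K N : ℝ) ≤ 8 * ((2 * M + 1) * (4 * N ^ 2 * (L + 1) ^ 2 + (2 * J + 1) * L ^ 4)) := by
  have hκ : 0 < 1 - C⁻¹ := sub_pos.2 (inv_lt_one_of_one_lt₀ hC)
  have hm : (⌊M⌋₊ : ℝ) ≤ M := Nat.floor_le hM
  have hL : ∀ x, L < x → 4 * K ≤ (1 - C⁻¹) * a x := by
    intro x hx
    have h := pow_mul_le_of_lacunary_of_le hC hpos hlac le_rfl (show 1 + L ≤ x by omega)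
    calc 4 * K ≤ 4 * M := by gcongr
      _ ≤ (1 - C⁻¹) * (C ^ L * a 1) := by linarith
      _ ≤ _ := by gcongr
  have h₁ := ncard_orderedSols_large (N := N) (m := ⌊M⌋₊) hC hpos hlac hL (by linarith)
  have h₂ := ncard_orderedSols_small (N := N) (m := ⌊M⌋₊) (L := L) hC hpos hlac hJ
  have h₃ := countB_le_orderedSols a M K N
  have h₄ : (orderedSols a K ⌊M⌋₊ N).ncard ≤
      (orderedSols a K ⌊M⌋₊ N ∩ {t | L < t.2.2.1}).ncard +
      (orderedSols a K ⌊M⌋₊ N ∩ {t | t.2.2.1 ≤ L}).ncard := by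
    refine (Set.ncard_le_ncard ?_ (((orderedSols_finite _ _ _ _).inter_of_left _).union
      ((orderedSols_finite _ _ _ _).inter_of_left _))).trans (Set.ncard_union_le _ _)
    intro t ht
    simp only [Set.mem_union, Set.mem_inter_iff, ht, true_and, Set.mem_ofPred_eq]
    omega
  have h₅ : countB a M K N ≤
      8 * ((2 * ⌊M⌋₊ + 1) * (4 * N ^ 2 * (L + 1) ^ 2 + (2 * J + 1) * L ^ 4)) := by
    linarith
  calc (countB a M K N : ℝ) ≤
      8 * ((2 * ⌊M⌋₊ + 1) * (4 * N ^ 2 * (L + 1) ^ 2 + (2 * J + 1) * L ^ 4)) := by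
        exact_mod_cast h₅
    _ ≤ _ := by gcongr

end Lacunary

/-- A power of `C > 1` exceeds `B * M` at an exponent that is `O(log M)`. -/
theorem exists_pow_ge_of_log {C B : ℝ} (hC : 1 < C) (hB : 1 ≤ B) :
    ∃ c : ℝ, 0 < c ∧ ∀ M : ℝ, 1 ≤ Real.log M → 0 < M →
      ∃ L : ℕ, B * M ≤ C ^ L ∧ (L : ℝ) + 1 ≤ c * Real.log M := by
  have hlC : 0 < Real.log C := Real.log_pos hC
  have hlB : 0 ≤ Real.log B := Real.log_nonneg hB
  refine ⟨(Real.log B + 1) / Real.log C + 2, by positivity, fun M hlM hM ↦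
    ⟨⌈Real.log (B * M) / Real.log C⌉₊, ?_, ?_⟩⟩
  · have h := Nat.le_ceil (Real.log (B * M) / Real.log C)
    rw [div_le_iff₀ hlC, ← Real.log_pow] at h
    exact (Real.log_le_log_iff (by positivity) (by positivity)).1 h
  · have hlBM : Real.log (B * M) = Real.log B + Real.log M :=
      Real.log_mul (by positivity) hM.ne'
    have h := Nat.ceil_lt_add_one (a := Real.log (B * M) / Real.log C)
      (div_nonneg (by linarith) hlC.le)
    have h' : Real.log (B * M) / Real.log C ≤ (Real.log B + 1) / Real.log C * Real.log M := by
      rw [hlBM, div_mul_eq_mul_div]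
      gcongr
      nlinarith
    nlinarith

/-- For a lacunary sequence of positive reals and `N^γ ≤ M ≤ N^Γ`
with `0 < γ < Γ < 2`, the number of solutions of the Diophantine inequality
`|n₁(a(x₁) − a(y₁)) − n₂(a(x₂) − a(y₂))| < N^ε` is `≪ M·N²·(log M)²`. -/
theorem countB_lacunary
    (a : ℕ → ℝ) (C : ℝ) (hC : 1 < C)
    (hpos : ∀ x : ℕ, 1 ≤ x → 0 < a x)
    (hlac : ∀ x : ℕ, 1 ≤ x → C * a x ≤ a (x + 1))
    (γ Γ ε : ℝ) (hγ : 0 < γ) (hγΓ : γ < Γ) (hΓ : Γ < 2) (hε : 0 < ε) (hεγ : ε < γ) :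
    ∃ c : ℝ, 0 < c ∧ ∃ N₀ : ℕ, ∀ N : ℕ, N₀ ≤ N → ∀ M : ℝ,
      (N : ℝ) ^ γ ≤ M → M ≤ (N : ℝ) ^ Γ →
      (countB a M ((N : ℝ) ^ ε) N : ℝ) ≤ c * M * (N : ℝ) ^ 2 * (Real.log M) ^ 2 := by
  have hκ : 0 < 1 - C⁻¹ := sub_pos.2 (inv_lt_one_of_one_lt₀ hC)
  have ha₁ := hpos 1 le_rfl
  set α := (1 - C⁻¹) * a 1 with hα_def
  have hα : 0 < α := by positivity
  set B := 1 + 8 / (1 - C⁻¹) + 4 / α with hB_def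
  have hB : 1 ≤ B := by
    have : 0 ≤ 8 / (1 - C⁻¹) + 4 / α := by positivity
    linarith
  obtain ⟨c, hc, hL⟩ := exists_pow_ge_of_log hC hB
  set η := (2 - ε) / 2 with hη_def
  have hη : 0 < η := by rw [hη_def]; linarith
  refine ⟨24 * (4 * c ^ 2 + (2 / α + 5) * c ^ 4 * (4 / η ^ 2)), by positivity,
    ⌈Real.exp (1 / γ)⌉₊, fun N hN M hM₁ hM₂ ↦ ?_⟩
  have hNexp : Real.exp (1 / γ) ≤ N := (Nat.le_ceil _).trans (by exact_mod_cast hN)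
  have hN₁ : (1 : ℝ) ≤ N := (Real.one_le_exp (by positivity)).trans hNexp
  have hN₀ : (0 : ℝ) < N := by linarith
  have hM₀ : 0 < M := (Real.rpow_pos_of_pos hN₀ γ).trans_le hM₁
  have hlogN : 1 / γ ≤ Real.log N := (Real.le_log_iff_exp_le hN₀).2 hNexp
  have hlogM : 1 ≤ Real.log M := by
    have h := Real.log_le_log (Real.rpow_pos_of_pos hN₀ γ) hM₁
    rw [Real.log_rpow hN₀] at h
    rw [div_le_iff₀ hγ] at hlogN
    linarith
  have hlogM' : Real.log M ≤ 2 * ((N : ℝ) ^ η / η) := by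
    have h := Real.log_le_log hM₀ hM₂
    rw [Real.log_rpow hN₀] at h
    have h' := Real.log_le_rpow_div hN₀.le hη
    have h₀ : 0 ≤ Real.log N := Real.log_nonneg hN₁
    nlinarith
  have hK₁ : 1 ≤ (N : ℝ) ^ ε := Real.one_le_rpow hN₁ hε.le
  have hKM : (N : ℝ) ^ ε ≤ M := (Real.rpow_le_rpow_of_exponent_le hN₁ hεγ.le).trans hM₁
  obtain ⟨L, hL, hLc⟩ := hL M hlogM hM₀
  have hL₁ : 4 * M ≤ α * C ^ L := by
    have : 4 / α ≤ B := by
      have : 0 ≤ 8 / (1 - C⁻¹) := by positivity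
      linarith
    calc 4 * M = α * (4 / α * M) := by field_simp
      _ ≤ α * (B * M) := by gcongr
      _ ≤ _ := by gcongr
  have hL₂ : 8 * M ≤ (1 - C⁻¹) * C ^ L := by
    have : 8 / (1 - C⁻¹) ≤ B := by
      have : 0 ≤ 4 / α := by positivity
      linarith
    calc 8 * M = (1 - C⁻¹) * (8 / (1 - C⁻¹) * M) := by
          rw [← mul_assoc, mul_div_cancel₀ _ hκ.ne']
      _ ≤ (1 - C⁻¹) * (B * M) := by gcongr
      _ ≤ _ := by gcongr
  have hJ := Nat.le_ceil ((N : ℝ) ^ ε / α + 1)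
  have hJ' := (Nat.ceil_lt_add_one (a := (N : ℝ) ^ ε / α + 1) (by positivity)).le
  set J := ⌈(N : ℝ) ^ ε / α + 1⌉₊
  have hJK : 2 * (J : ℝ) + 1 ≤ (2 / α + 5) * (N : ℝ) ^ ε := by
    have : (2 / α + 5) * (N : ℝ) ^ ε = 2 * ((N : ℝ) ^ ε / α) + 5 * (N : ℝ) ^ ε := by ring
    linarith
  have hM1 : 1 ≤ M := hK₁.trans hKM
  have hpow : (N : ℝ) ^ ε * Real.log M ^ 2 ≤ 4 / η ^ 2 * (N : ℝ) ^ 2 := by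
    have hsq : (N : ℝ) ^ ε * ((N : ℝ) ^ η) ^ 2 = (N : ℝ) ^ 2 := by
      rw [← Real.rpow_natCast ((N : ℝ) ^ η), ← Real.rpow_mul hN₀.le, ← Real.rpow_add hN₀,
        ← Real.rpow_natCast (N : ℝ) 2]
      congr 1
      rw [hη_def]
      push_cast
      ring
    calc (N : ℝ) ^ ε * Real.log M ^ 2 ≤ (N : ℝ) ^ ε * (2 * ((N : ℝ) ^ η / η)) ^ 2 := by gcongr
      _ = 4 / η ^ 2 * ((N : ℝ) ^ ε * ((N : ℝ) ^ η) ^ 2) := by ring_nf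
      _ = _ := by rw [hsq]
  have hL₄ : (2 * (J : ℝ) + 1) * (L : ℝ) ^ 4 ≤
      (2 / α + 5) * c ^ 4 * (4 / η ^ 2) * (N : ℝ) ^ 2 * Real.log M ^ 2 := by
    have hLc' : (L : ℝ) ≤ c * Real.log M := by linarith
    calc (2 * (J : ℝ) + 1) * (L : ℝ) ^ 4
        ≤ ((2 / α + 5) * (N : ℝ) ^ ε) * (c * Real.log M) ^ 4 := by gcongr
      _ = (2 / α + 5) * c ^ 4 * ((N : ℝ) ^ ε * Real.log M ^ 2) * Real.log M ^ 2 := by ring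
      _ ≤ (2 / α + 5) * c ^ 4 * (4 / η ^ 2 * (N : ℝ) ^ 2) * Real.log M ^ 2 := by gcongr
      _ = _ := by ring
  calc (countB a M ((N : ℝ) ^ ε) N : ℝ)
      ≤ 8 * ((2 * M + 1) * (4 * N ^ 2 * (L + 1) ^ 2 + (2 * J + 1) * L ^ 4)) :=
        countB_le hC hpos hlac hM₀.le hKM hL₁ hL₂ hJ
    _ ≤ 8 * ((3 * M) * (4 * N ^ 2 * (c * Real.log M) ^ 2 +
          (2 / α + 5) * c ^ 4 * (4 / η ^ 2) * (N : ℝ) ^ 2 * Real.log M ^ 2)) := by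
        gcongr
        linarith
    _ = _ := by ring
end
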